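/- Let n ≥ 5 be a prime number and let q be a prime power with q ≥ 2^{(13/3)n + 4}. Then for all integers 1 ≤ I < J ≤ n−1 and all α ∈ F_{q^n} ∖ {0}, the binomial f(x) = x^{q^I} + α x^{q^J} is scattered over F_{q^n} if and only if I + J = n and N_{q^n/q}(α) ≠ 1; that is, the only scattered binomials over F_{q^n} are of Lunardon–Polverino type δx^{q^s} + x^{q^{n−s}} with N_{q^n/q}(δ) ∉ {0,1}. -/

import Mathlib

/-- An `F_q`-linearized map `f` on a field `F` (of size `q ^ n`) is *scattered* if for all
nonzero `x, y`, `f x / x = f y / y` implies that `x / y` lies in the subfield `F_q`,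
identified with the set of fixed points of `z ↦ z ^ q`. -/
def IsScattered (q : ℕ) {F : Type*} [Field F] (f : F → F) : Prop :=
  ∀ x y : F, x ≠ 0 → y ≠ 0 → f x / x = f y / y → (x / y) ^ q = x / y

section

open Polynomial

section WeightFiltration

variable {K R : Type*} [Field K] [CommRing R] [Algebra K R]

/-- The span of the monomials `v ^ e * y ^ i * w ^ j` of weight at most `ω`, where `v` has weight
`1` and `y`, `w` have weight `δ`. -/
def wtSpan (K : Type*) {R : Type*} [Field K] [CommRing R] [Algebra K R] (v y w : R) (δ : ℕ)
    (ω : ℤ) : Submodule K R :=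
  Submodule.span K {x | ∃ e i j : ℕ, (e : ℤ) + δ * (i + j) ≤ ω ∧ x = v ^ e * y ^ i * w ^ j}

variable {v y w : R} {δ : ℕ}

theorem wtSpan_mono {ω ω' : ℤ} (h : ω ≤ ω') : wtSpan K v y w δ ω ≤ wtSpan K v y w δ ω' := by
  apply Submodule.span_mono
  rintro x ⟨e, i, j, h1, rfl⟩
  exact ⟨e, i, j, h1.trans h, rfl⟩

theorem mem_wtSpan {ω : ℤ} (e i j : ℕ) (h : (e : ℤ) + δ * (i + j) ≤ ω) :
    v ^ e * y ^ i * w ^ j ∈ wtSpan K v y w δ ω :=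
  Submodule.subset_span ⟨e, i, j, h, rfl⟩

theorem left_mem_wtSpan : v ∈ wtSpan K v y w δ 1 := by
  simpa using mem_wtSpan (K := K) (v := v) (y := y) (w := w) (δ := δ) (ω := 1) 1 0 0 (by simp)

theorem middle_mem_wtSpan : y ∈ wtSpan K v y w δ δ := by
  simpa using mem_wtSpan (K := K) (v := v) (y := y) (w := w) (δ := δ) (ω := δ) 0 1 0 (by simp)

theorem mul_mem_wtSpan {ω ω' : ℤ} {a b : R} (ha : a ∈ wtSpan K v y w δ ω)
    (hb : b ∈ wtSpan K v y w δ ω') : a * b ∈ wtSpan K v y w δ (ω + ω') := by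
  have h := Submodule.mul_mem_mul ha hb
  rw [wtSpan, wtSpan, Submodule.span_mul_span] at h
  refine Submodule.span_mono ?_ h
  rintro _ ⟨_, ⟨e, i, j, h1, rfl⟩, _, ⟨e', i', j', h2, rfl⟩, rfl⟩
  refine ⟨e + e', i + i', j + j', ?_, by ring⟩
  push_cast
  linarith

theorem one_mem_wtSpan {ω : ℤ} (h : 0 ≤ ω) : (1 : R) ∈ wtSpan K v y w δ ω := by
  simpa using mem_wtSpan (K := K) (v := v) (y := y) (w := w) (δ := δ) 0 0 0 (by simpa using h)

theorem pow_mem_wtSpan {ω : ℤ} {a : R} (ha : a ∈ wtSpan K v y w δ ω) (k : ℕ) :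
    a ^ k ∈ wtSpan K v y w δ (k * ω) := by
  induction k with
  | zero => simpa using one_mem_wtSpan le_rfl
  | succ k ih =>
    rw [pow_succ]
    convert mul_mem_wtSpan ih ha using 2
    push_cast; ring

/-- The power series whose `m`-th coefficient has weight at most `ω + m * C`. -/
def wtSeries (K : Type*) {R : Type*} [Field K] [CommRing R] [Algebra K R] (v y w : R) (δ : ℕ)
    (C : ℤ) (ω : ℤ) : Submodule K (PowerSeries R) where
  carrier := {x | ∀ m : ℕ, PowerSeries.coeff m x ∈ wtSpan K v y w δ (ω + m * C)}
  add_mem' {a b} ha hb m := by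
    rw [map_add]
    exact Submodule.add_mem _ (ha m) (hb m)
  zero_mem' m := by simp
  smul_mem' c x hx m := by
    have : PowerSeries.coeff m (c • x) = c • PowerSeries.coeff m x := by
      rfl
    rw [this]
    exact Submodule.smul_mem _ _ (hx m)

variable {C : ℤ}

theorem wtSeries_mono {ω ω' : ℤ} (h : ω ≤ ω') :
    wtSeries K v y w δ C ω ≤ wtSeries K v y w δ C ω' := fun _ hx m =>
  wtSpan_mono (by linarith) (hx m)

theorem mul_mem_wtSeries {ω ω' : ℤ} {a b : PowerSeries R} (ha : a ∈ wtSeries K v y w δ C ω)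
    (hb : b ∈ wtSeries K v y w δ C ω') : a * b ∈ wtSeries K v y w δ C (ω + ω') := by
  intro m
  rw [PowerSeries.coeff_mul]
  refine Submodule.sum_mem _ fun i hi => ?_
  have h1 := mul_mem_wtSpan (ha i.1) (hb i.2)
  have h2 : i.1 + i.2 = m := by simpa using hi
  convert h1 using 2
  rw [← h2]
  push_cast; ring

theorem C_mem_wtSeries {ω : ℤ} {a : R} (ha : a ∈ wtSpan K v y w δ ω) :
    PowerSeries.C a ∈ wtSeries K v y w δ C ω := by
  intro m
  rw [PowerSeries.coeff_C]
  split_ifs with h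
  · subst h; simpa using ha
  · exact Submodule.zero_mem _

theorem X_mem_wtSeries : (PowerSeries.X : PowerSeries R) ∈ wtSeries K v y w δ C (-C) := by
  intro m
  rw [PowerSeries.coeff_X]
  split_ifs with h
  · subst h; exact one_mem_wtSpan (by simp)
  · exact Submodule.zero_mem _

theorem one_mem_wtSeries : (1 : PowerSeries R) ∈ wtSeries K v y w δ C 0 := by
  simpa using C_mem_wtSeries (C := C) (one_mem_wtSpan (K := K) (v := v) (y := y) (w := w) (δ := δ)
    (le_refl (0 : ℤ)))

theorem pow_mem_wtSeries {ω : ℤ} {a : PowerSeries R} (ha : a ∈ wtSeries K v y w δ C ω) (k : ℕ) :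
    a ^ k ∈ wtSeries K v y w δ C (k * ω) := by
  induction k with
  | zero => simpa using one_mem_wtSeries
  | succ k ih =>
    rw [pow_succ]
    convert mul_mem_wtSeries ih ha using 2
    push_cast; ring

theorem nat_mul_mem_wtSeries {ω : ℤ} {a : PowerSeries R} (ha : a ∈ wtSeries K v y w δ C ω) (k : ℕ) :
    (k : PowerSeries R) * a ∈ wtSeries K v y w δ C ω := by
  rw [← nsmul_eq_mul]
  exact (wtSeries K v y w δ C ω).nsmul_mem ha k

end WeightFiltration

/-- A contraction of a coefficientwise defined set of power series has a fixed point. -/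
theorem PowerSeries.exists_fixedPoint {R : Type*} [CommRing R] (P : ℕ → R → Prop)
    (h0 : ∀ m, P m 0) (Ψ : PowerSeries R → PowerSeries R)
    (hΨ : ∀ z, (∀ m, P m (coeff m z)) → ∀ m, P m (coeff m (Ψ z)))
    (hcontr : ∀ z z', (∀ m, P m (coeff m z)) → (∀ m, P m (coeff m z')) → ∀ m,
      X ^ m ∣ z - z' → X ^ (m + 1) ∣ Ψ z - Ψ z') :
    ∃ z, (∀ m, P m (coeff m z)) ∧ Ψ z = z := by
  let it : ℕ → PowerSeries R := fun n => Ψ^[n] 0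
  have it_succ : ∀ n, it (n + 1) = Ψ (it n) := fun n => Function.iterate_succ_apply' _ _ _
  have hP : ∀ n m, P m (coeff m (it n)) := by
    intro n
    induction n with
    | zero => intro m; simpa [it] using h0 m
    | succ n ih => rw [it_succ]; exact hΨ _ ih
  have hstep : ∀ n, X ^ n ∣ it (n + 1) - it n := by
    intro n
    induction n with
    | zero => simp
    | succ n ih =>
      rw [it_succ (n + 1)]
      nth_rewrite 2 [it_succ n]
      exact hcontr _ _ (hP _) (hP _) n ih
  have hlong : ∀ n k, X ^ n ∣ it (n + k) - it n := by
    intro n k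
    induction k with
    | zero => simp
    | succ k ih =>
      have h1 := (pow_dvd_pow (X : PowerSeries R) (Nat.le_add_right n k)).trans (hstep (n + k))
      simpa [← add_assoc] using dvd_add h1 ih
  let z : PowerSeries R := mk fun m => coeff m (it (m + 1))
  have hz : ∀ n, X ^ n ∣ z - it n := by
    intro n
    rw [X_pow_dvd_iff]
    intro m hm
    obtain ⟨k, rfl⟩ := Nat.exists_eq_add_of_lt hm
    have := X_pow_dvd_iff.1 (hlong (m + 1) k) m (by omega)
    rw [map_sub, sub_eq_zero] at this ⊢
    rw [show m + k + 1 = m + 1 + k by ring, this]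
    simp [z]
  have hPz : ∀ m, P m (coeff m z) := by
    intro m
    simpa [z] using hP (m + 1) m
  refine ⟨z, hPz, ?_⟩
  ext m
  have h1 := hcontr _ _ hPz (hP m) m (hz m)
  rw [← it_succ] at h1
  have h2 := dvd_sub h1 (hz (m + 1))
  have h3 := X_pow_dvd_iff.1 h2 m (by omega)
  simpa [sub_eq_zero] using h3

section Bivariate

variable {K S T : Type*} [CommRing K] [CommRing S] [CommRing T]

/-- Evaluation of a bivariate polynomial along a homomorphism of coefficient rings. -/
noncomputable def bev (φ : K →+* S) (v y : S) : K[X][X] →+* S :=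
  eval₂RingHom (eval₂RingHom φ v) y

theorem bev_apply (φ : K →+* S) (v y : S) (G : K[X][X]) :
    bev φ v y G = ∑ j ∈ Finset.range (G.natDegree + 1), (G.coeff j).eval₂ φ v * y ^ j := by
  simp [bev, eval₂_eq_sum_range]

theorem map_bev (ψ : S →+* T) (φ : K →+* S) (v y : S) (G : K[X][X]) :
    ψ (bev φ v y G) = bev (ψ.comp φ) (ψ v) (ψ y) G := by
  simp [bev_apply, hom_eval₂]

@[simp] theorem bev_X (φ : K →+* S) (v y : S) : bev φ v y X = y := by simp [bev]

@[simp] theorem bev_C (φ : K →+* S) (v y : S) (a : K[X]) : bev φ v y (C a) = a.eval₂ φ v := by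
  simp [bev]

/-- `(v + V) ^ a = v ^ a + V * linRem v V a`. -/
def linRem (v V : S) : ℕ → S
  | 0 => 0
  | a + 1 => (v + V) * linRem v V a + v ^ a

/-- `(y + Z) ^ j = y ^ j + j * y ^ (j - 1) * Z + Z ^ 2 * sqRem y Z j`. -/
def sqRem (y Z : S) : ℕ → S
  | 0 => 0
  | j + 1 => (y + Z) * sqRem y Z j + j * y ^ (j - 1)

theorem add_pow_eq_linRem (v V : S) (a : ℕ) : (v + V) ^ a = v ^ a + V * linRem v V a := by
  induction a with
  | zero => simp [linRem]
  | succ a ih => rw [pow_succ, ih, linRem]; ring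

theorem add_pow_eq_sqRem (y Z : S) (j : ℕ) :
    (y + Z) ^ j = y ^ j + j * y ^ (j - 1) * Z + Z ^ 2 * sqRem y Z j := by
  induction j with
  | zero => simp [sqRem]
  | succ j ih =>
    rw [pow_succ, ih, sqRem]
    rcases j with _ | j
    · simp [sqRem]
    · simp only [Nat.add_sub_cancel]
      push_cast
      ring

theorem bev_add_left (φ : K →+* S) (v V y : S) (G : K[X][X]) :
    bev φ (v + V) y G = bev φ v y G + V * ∑ j ∈ Finset.range (G.natDegree + 1),
      (∑ a ∈ Finset.range ((G.coeff j).natDegree + 1), φ ((G.coeff j).coeff a) * linRem v V a)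
        * y ^ j := by
  rw [bev_apply, bev_apply, Finset.mul_sum, ← Finset.sum_add_distrib]
  refine Finset.sum_congr rfl fun j _ => ?_
  rw [eval₂_eq_sum_range, eval₂_eq_sum_range, ← mul_assoc, ← add_mul, Finset.mul_sum,
    ← Finset.sum_add_distrib]
  congr 1
  refine Finset.sum_congr rfl fun a _ => ?_
  rw [add_pow_eq_linRem]; ring

theorem bev_derivative (φ : K →+* S) (v y : S) (G : K[X][X]) :
    bev φ v y (derivative G) = ∑ j ∈ Finset.range (G.natDegree + 1),
      (G.coeff j).eval₂ φ v * (j * y ^ (j - 1)) := by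
  rw [derivative_apply, Polynomial.sum_over_range _ (by simp), map_sum]
  refine Finset.sum_congr rfl fun j _ => ?_
  rw [map_mul, map_pow, bev_X, bev_C, eval₂_mul, eval₂_natCast, mul_assoc]

theorem bev_add_right (φ : K →+* S) (v y Z : S) (G : K[X][X]) :
    bev φ v (y + Z) G = bev φ v y G + bev φ v y (derivative G) * Z +
      Z ^ 2 * ∑ j ∈ Finset.range (G.natDegree + 1), (G.coeff j).eval₂ φ v * sqRem y Z j := by
  rw [bev_derivative, bev_apply, bev_apply, Finset.mul_sum, Finset.sum_mul,
    ← Finset.sum_add_distrib, ← Finset.sum_add_distrib]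
  refine Finset.sum_congr rfl fun j _ => ?_
  rw [add_pow_eq_sqRem]; ring

end Bivariate

section Weight

variable {K R : Type*} [Field K] [CommRing R] [Algebra K R]

/-- Every monomial of `G` has weight at most `ω`, where the inner variable has weight `1` and the
outer variable has weight `δ`. -/
def WtLE (δ : ℕ) (G : K[X][X]) (ω : ℕ) : Prop :=
  ∀ j a, (G.coeff j).coeff a ≠ 0 → a + δ * j ≤ ω

variable {v y w : R} {δ : ℕ}

theorem WtLE.derivative {G : K[X][X]} {r : ℕ} (hG : WtLE δ G (r * δ)) (hr : 1 ≤ r) :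
    WtLE δ (derivative G) ((r - 1) * δ) := by
  intro j a h
  rw [coeff_derivative] at h
  have h1 : (G.coeff (j + 1)).coeff a ≠ 0 := by
    intro h0
    apply h
    have : (j : K[X]) + 1 = C ((j : K) + 1) := by simp
    rw [this, coeff_mul_C, h0, zero_mul]
  have h2 := hG _ _ h1
  obtain ⟨r, rfl⟩ := Nat.exists_eq_add_of_le hr
  simp only [Nat.add_sub_cancel_left]
  nlinarith

theorem bev_mem_wtSpan {G : K[X][X]} {ω : ℕ} (hG : WtLE δ G ω) :
    bev (algebraMap K R) v y G ∈ wtSpan K v y w δ ω := by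
  rw [bev_apply]
  refine Submodule.sum_mem _ fun j _ => ?_
  rw [eval₂_eq_sum_range, Finset.sum_mul]
  refine Submodule.sum_mem _ fun a _ => ?_
  rw [mul_assoc, ← Algebra.smul_def]
  by_cases h : (G.coeff j).coeff a = 0
  · simp [h]
  · refine Submodule.smul_mem _ _ ?_
    have := mem_wtSpan (K := K) (v := v) (y := y) (w := w) (δ := δ) (ω := ω) a j 0
      (by have := hG _ _ h; push_cast; zify at this; linarith)
    simpa using this

end Weight

section Taylor

variable {K R : Type*} [Field K] [CommRing R] [Algebra K R] {v y w : R} {δ : ℕ} {C : ℤ}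

theorem linRem_mem_wtSeries {v' V : PowerSeries R} (hv : v' ∈ wtSeries K v y w δ C 1)
    (hV : V ∈ wtSeries K v y w δ C 1) (a : ℕ) :
    linRem v' V a ∈ wtSeries K v y w δ C (a - 1) := by
  induction a with
  | zero => exact Submodule.zero_mem _
  | succ a ih =>
    rw [linRem]
    refine Submodule.add_mem _ ?_ ?_
    · exact wtSeries_mono (by push_cast; linarith) (mul_mem_wtSeries (Submodule.add_mem _ hv hV) ih)
    · exact wtSeries_mono (by push_cast; linarith) (pow_mem_wtSeries hv a)

theorem sqRem_mem_wtSeries {y' Z : PowerSeries R} (hy : y' ∈ wtSeries K v y w δ C δ)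
    (hZ : Z ∈ wtSeries K v y w δ C δ) (j : ℕ) :
    sqRem y' Z j ∈ wtSeries K v y w δ C (j * δ - 2 * δ) := by
  induction j with
  | zero => exact Submodule.zero_mem _
  | succ j ih =>
    rw [sqRem]
    refine Submodule.add_mem _ ?_ ?_
    · exact wtSeries_mono (by push_cast; linarith) (mul_mem_wtSeries (Submodule.add_mem _ hy hZ) ih)
    · rcases j with _ | j
      · simp
      · refine wtSeries_mono ?_ (nat_mul_mem_wtSeries (pow_mem_wtSeries hy (j + 1 - 1)) _)
        simp only [Nat.add_sub_cancel]
        push_cast; linarith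

theorem dvd_sqRem_sub {S : Type*} [CommRing S] {d y' Z Z' : S} (h : d ∣ Z - Z') (j : ℕ) :
    d ∣ sqRem y' Z j - sqRem y' Z' j := by
  induction j with
  | zero => simp [sqRem]
  | succ j ih =>
    have h1 : sqRem y' Z (j + 1) - sqRem y' Z' (j + 1) =
        (Z - Z') * sqRem y' Z j + (y' + Z') * (sqRem y' Z j - sqRem y' Z' j) := by
      simp only [sqRem]; ring
    rw [h1]
    exact dvd_add (h.mul_right _) (ih.mul_left _)

theorem coeff_smul_mem_wtSeries {G : K[X][X]} {ω : ℕ} (hG : WtLE δ G ω) {ω' : ℤ}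
    (x : PowerSeries R) (j a : ℕ)
    (h : a + δ * j ≤ ω → x ∈ wtSeries K v y w δ C ω') :
    (PowerSeries.C.comp (algebraMap K R)) ((G.coeff j).coeff a) * x ∈ wtSeries K v y w δ C ω' := by
  by_cases h0 : (G.coeff j).coeff a = 0
  · simp [h0]
  · have h1 := h (hG _ _ h0)
    have h2 := (wtSeries K v y w δ C ω').smul_mem ((G.coeff j).coeff a) h1
    convert h2 using 1
    ext m
    rw [RingHom.comp_apply, PowerSeries.coeff_C_mul, ← Algebra.smul_def]
    rfl

theorem exists_taylor (w : R) {r : ℕ} (hr : 1 ≤ r) {G : K[X][X]} (hG : WtLE δ G (r * δ))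
    (h0 : bev (algebraMap K R) v y G = 0) {f : R}
    (hf : f = bev (algebraMap K R) v y (derivative G)) {φ : ℤ} (hφ : φ = (r - 1) * δ) :
    ∃ z : PowerSeries R, PowerSeries.X ∣ z ∧ (∀ a i : ℕ,
      (PowerSeries.C v + PowerSeries.C (f ^ 2) * PowerSeries.X) ^ a *
        (PowerSeries.C y + PowerSeries.C f * z) ^ i ∈
          wtSeries K v y w δ (2 * φ) (a + i * δ)) ∧
      bev (PowerSeries.C.comp (algebraMap K R)) (PowerSeries.C v + PowerSeries.C (f ^ 2) *
        PowerSeries.X) (PowerSeries.C y + PowerSeries.C f * z) G = 0 := by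
  let ι : K →+* PowerSeries R := PowerSeries.C.comp (algebraMap K R)
  let V : PowerSeries R := PowerSeries.C (f ^ 2) * PowerSeries.X
  let Y : PowerSeries R → PowerSeries R := fun z => PowerSeries.C y + PowerSeries.C f * z
  let Lc : ℕ → PowerSeries R := fun j => ∑ a ∈ Finset.range ((G.coeff j).natDegree + 1),
    ι ((G.coeff j).coeff a) * linRem (PowerSeries.C v) V a
  let Ψ : PowerSeries R → PowerSeries R := fun z =>
    -(PowerSeries.X * ∑ j ∈ Finset.range (G.natDegree + 1), Lc j * Y z ^ j +
      z ^ 2 * ∑ j ∈ Finset.range (G.natDegree + 1),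
        (G.coeff j).eval₂ ι (PowerSeries.C v) * sqRem (PowerSeries.C y) (PowerSeries.C f * z) j)
  have hfW : f ∈ wtSpan K v y w δ φ := by
    have := bev_mem_wtSpan (K := K) (v := v) (y := y) (w := w) (hG.derivative hr)
    rw [← hf] at this
    convert this using 2
    rw [hφ]; push_cast [hr]; ring
  have hvW : PowerSeries.C v ∈ wtSeries K v y w δ (2 * φ) 1 :=
    C_mem_wtSeries left_mem_wtSpan
  have hyW : PowerSeries.C y ∈ wtSeries K v y w δ (2 * φ) δ :=
    C_mem_wtSeries middle_mem_wtSpan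
  have hVW : V ∈ wtSeries K v y w δ (2 * φ) 1 := by
    have := mul_mem_wtSeries (C_mem_wtSeries (C := 2 * φ) (pow_mem_wtSpan hfW 2)) X_mem_wtSeries
    exact wtSeries_mono (by push_cast; linarith) this
  have hZW : ∀ z ∈ wtSeries K v y w δ (2 * φ) (δ - φ),
      PowerSeries.C f * z ∈ wtSeries K v y w δ (2 * φ) δ := fun z hz =>
    wtSeries_mono (by linarith) (mul_mem_wtSeries (C_mem_wtSeries hfW) hz)
  have hΨW : ∀ z ∈ wtSeries K v y w δ (2 * φ) (δ - φ),
      Ψ z ∈ wtSeries K v y w δ (2 * φ) (δ - φ) := by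
    intro z hz
    refine Submodule.neg_mem _ (Submodule.add_mem _ ?_ ?_)
    · have : ∑ j ∈ Finset.range (G.natDegree + 1), Lc j * Y z ^ j ∈
          wtSeries K v y w δ (2 * φ) (r * δ - 1) := by
        refine Submodule.sum_mem _ fun j _ => ?_
        rw [Finset.sum_mul]
        refine Submodule.sum_mem _ fun a _ => ?_
        rw [mul_assoc]
        refine coeff_smul_mem_wtSeries hG _ j a fun h => ?_
        refine wtSeries_mono ?_ (mul_mem_wtSeries (linRem_mem_wtSeries hvW hVW a)
          (pow_mem_wtSeries (Submodule.add_mem _ hyW (hZW z hz)) j))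
        zify at h
        linarith
      refine wtSeries_mono ?_ (mul_mem_wtSeries X_mem_wtSeries this)
      rw [hφ]; linarith
    · have : ∑ j ∈ Finset.range (G.natDegree + 1),
        (G.coeff j).eval₂ ι (PowerSeries.C v) * sqRem (PowerSeries.C y) (PowerSeries.C f * z) j ∈
          wtSeries K v y w δ (2 * φ) (r * δ - 2 * δ) := by
        refine Submodule.sum_mem _ fun j _ => ?_
        rw [eval₂_eq_sum_range, Finset.sum_mul]
        refine Submodule.sum_mem _ fun a _ => ?_
        rw [mul_assoc]
        refine coeff_smul_mem_wtSeries hG _ j a fun h => ?_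
        refine wtSeries_mono ?_ (mul_mem_wtSeries (pow_mem_wtSeries hvW a)
          (sqRem_mem_wtSeries hyW (hZW z hz) j))
        zify at h
        linarith
      refine wtSeries_mono ?_ (mul_mem_wtSeries (pow_mem_wtSeries hz 2) this)
      rw [hφ]; push_cast; linarith
  obtain ⟨z, hz, hfix⟩ := PowerSeries.exists_fixedPoint
    (fun m x => x ∈ wtSpan K v y w δ (δ - φ + m * (2 * φ)) ∧ (m = 0 → x = 0))
    (fun m => ⟨Submodule.zero_mem _, fun _ => rfl⟩) Ψ
    (by
      intro z hz m
      refine ⟨hΨW z (fun m => (hz m).1) m, ?_⟩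
      rintro rfl
      have h1 : PowerSeries.X ∣ z := PowerSeries.X_dvd_iff.2 (by simpa using (hz 0).2 rfl)
      have h2 : PowerSeries.X ∣ Ψ z :=
        (dvd_add (dvd_mul_right _ _) ((dvd_pow h1 two_ne_zero).mul_right _)).neg_right
      simpa using PowerSeries.X_dvd_iff.1 h2)
    (by
      intro z z' hz hz' m hm
      have h1 : PowerSeries.X ∣ z := PowerSeries.X_dvd_iff.2 (by simpa using (hz 0).2 rfl)
      have h1' : PowerSeries.X ∣ z' := PowerSeries.X_dvd_iff.2 (by simpa using (hz' 0).2 rfl)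
      have h2 : PowerSeries.X ^ m ∣ PowerSeries.C f * z - PowerSeries.C f * z' := by
        rw [← mul_sub]; exact hm.mul_left _
      have h3 : PowerSeries.X ^ m ∣ ∑ j ∈ Finset.range (G.natDegree + 1), Lc j * Y z' ^ j -
          ∑ j ∈ Finset.range (G.natDegree + 1), Lc j * Y z ^ j := by
        rw [← Finset.sum_sub_distrib]
        refine Finset.dvd_sum fun j _ => ?_
        rw [← mul_sub]
        refine Dvd.dvd.mul_left ?_ _
        refine dvd_trans ?_ (sub_dvd_pow_sub_pow _ _ j)
        rw [dvd_sub_comm]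
        simpa [Y] using h2
      set Sq : PowerSeries R → PowerSeries R := fun z => ∑ j ∈ Finset.range (G.natDegree + 1),
        (G.coeff j).eval₂ ι (PowerSeries.C v) *
          sqRem (PowerSeries.C y) (PowerSeries.C f * z) j with hSq
      have h4 : PowerSeries.X ^ m ∣ Sq z' - Sq z := by
        simp only [hSq]
        rw [← Finset.sum_sub_distrib]
        refine Finset.dvd_sum fun j _ => ?_
        rw [← mul_sub]
        refine Dvd.dvd.mul_left ?_ _
        rw [dvd_sub_comm]
        exact dvd_sqRem_sub h2 j
      have h5 : Ψ z - Ψ z' = PowerSeries.X * (∑ j ∈ Finset.range (G.natDegree + 1), Lc j * Y z' ^ j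
          -
          ∑ j ∈ Finset.range (G.natDegree + 1), Lc j * Y z ^ j) + z ^ 2 * (Sq z' - Sq z)
            - (z - z') * ((z + z') * Sq z') := by
        simp only [Ψ, hSq]; ring
      rw [h5, pow_succ']
      refine dvd_sub (dvd_add (mul_dvd_mul_left _ h3) (mul_dvd_mul (dvd_pow h1 two_ne_zero) h4)) ?_
      rw [mul_comm]
      exact mul_dvd_mul hm ((dvd_add h1 h1').mul_right _))
  refine ⟨z, PowerSeries.X_dvd_iff.2 (by simpa using (hz 0).2 rfl), fun a i => ?_, ?_⟩
  · have := mul_mem_wtSeries (pow_mem_wtSeries (Submodule.add_mem _ hvW hVW) a)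
      (pow_mem_wtSeries (Submodule.add_mem _ hyW (hZW z fun m => (hz m).1)) i)
    exact wtSeries_mono (by linarith) this
  have e1 : bev ι (PowerSeries.C v) (PowerSeries.C y) G = 0 := by
    rw [← map_bev, h0, map_zero]
  have e2 : bev ι (PowerSeries.C v) (PowerSeries.C y) (derivative G) = PowerSeries.C f := by
    rw [← map_bev, hf]
  change bev ι (PowerSeries.C v + V) (Y z) G = 0
  rw [bev_add_left, bev_add_right, e1, e2]
  have hfix' : z + (PowerSeries.X * ∑ j ∈ Finset.range (G.natDegree + 1), Lc j * Y z ^ j +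
      z ^ 2 * ∑ j ∈ Finset.range (G.natDegree + 1),
        (G.coeff j).eval₂ ι (PowerSeries.C v) *
          sqRem (PowerSeries.C y) (PowerSeries.C f * z) j) = 0 := by
    nth_rewrite 1 [← hfix]
    simp only [Ψ, neg_add_cancel]
  have hV : V = PowerSeries.C f ^ 2 * PowerSeries.X := by simp [V]
  linear_combination PowerSeries.C f ^ 2 * hfix' +
    (∑ j ∈ Finset.range (G.natDegree + 1), Lc j * Y z ^ j) * hV

end Taylor

section Reduced

variable {K R : Type*} [Field K] [CommRing R] [Algebra K R] {v y w : R} {δ : ℕ}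

/-- The span of the monomials of weight at most `ω` with bounded exponents of `y` and `w`. -/
def redSpan (K : Type*) {R : Type*} [Field K] [CommRing R] [Algebra K R] (v y w : R) (δ r s : ℕ)
    (ω : ℤ) : Submodule K R :=
  Submodule.span K {x | ∃ e i j : ℕ, (e : ℤ) + δ * (i + j) ≤ ω ∧ i < r ∧ j < s ∧
    x = v ^ e * y ^ i * w ^ j}

theorem wtSpan_le_redSpan {r s : ℕ} (hy : y ^ r ∈ redSpan K v y w δ r 1 (r * δ))
    (hw : w ^ s ∈ Submodule.span K {x | ∃ e i j : ℕ, (e : ℤ) + δ * (i + j) ≤ s * δ ∧ j < s ∧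
      x = v ^ e * y ^ i * w ^ j}) (ω : ℤ) : wtSpan K v y w δ ω ≤ redSpan K v y w δ r s ω := by
  have hstep1 : ∀ j, j < s → ∀ i e : ℕ, (e : ℤ) + δ * (i + j) ≤ ω →
      v ^ e * y ^ i * w ^ j ∈ redSpan K v y w δ r s ω := by
    intro j hj i
    induction i using Nat.strong_induction_on with
    | _ i ih =>
      intro e he
      by_cases hi : i < r
      · exact Submodule.subset_span ⟨e, i, j, he, hi, hj, rfl⟩
      · push Not at hi
        obtain ⟨k, rfl⟩ := Nat.exists_eq_add_of_le hi
        have : v ^ e * y ^ (r + k) * w ^ j = (v ^ e * y ^ k * w ^ j) * y ^ r := by ring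
        rw [this]
        unfold redSpan at hy
        generalize y ^ r = t at hy ⊢
        induction hy using Submodule.span_induction with
        | mem x hx =>
          obtain ⟨e', i', j', h1, h2, h3, rfl⟩ := hx
          obtain rfl : j' = 0 := by omega
          have := ih (i' + k) (by omega) (e + e') (by push_cast at *; linarith)
          convert this using 1
          ring
        | zero => simp
        | add x y _ _ hx hy => rw [mul_add]; exact Submodule.add_mem _ hx hy
        | smul a x _ hx => rw [mul_smul_comm]; exact Submodule.smul_mem _ _ hx
  have hstep2 : ∀ j i e : ℕ, (e : ℤ) + δ * (i + j) ≤ ω →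
      v ^ e * y ^ i * w ^ j ∈ redSpan K v y w δ r s ω := by
    intro j
    induction j using Nat.strong_induction_on with
    | _ j ih =>
      intro i e he
      by_cases hj : j < s
      · exact hstep1 j hj i e he
      · push Not at hj
        obtain ⟨k, rfl⟩ := Nat.exists_eq_add_of_le hj
        have : v ^ e * y ^ i * w ^ (s + k) = (v ^ e * y ^ i * w ^ k) * w ^ s := by ring
        rw [this]
        generalize w ^ s = t at hw ⊢
        induction hw using Submodule.span_induction with
        | mem x hx =>
          obtain ⟨e', i', j', h1, h2, rfl⟩ := hx
          have := ih (j' + k) (by omega) (i + i') (e + e') (by push_cast at *; linarith)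
          convert this using 1
          ring
        | zero => simp
        | add x y _ _ hx hy => rw [mul_add]; exact Submodule.add_mem _ hx hy
        | smul a x _ hx => rw [mul_smul_comm]; exact Submodule.smul_mem _ _ hx
  refine Submodule.span_le.2 ?_
  rintro x ⟨e, i, j, h, rfl⟩
  exact hstep2 j i e h

theorem finrank_redSpan_le (r s ω : ℕ) :
    Module.Finite K (redSpan K v y w δ r s ω) ∧
      Module.finrank K (redSpan K v y w δ r s ω) ≤ r * s * (ω + 1) := by
  classical
  set S : Finset R := ((Finset.range (ω + 1)) ×ˢ (Finset.range r) ×ˢ (Finset.range s)).image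
    fun x => v ^ x.1 * y ^ x.2.1 * w ^ x.2.2 with hS
  have hle : redSpan K v y w δ r s ω ≤ Submodule.span K (S : Set R) := by
    refine Submodule.span_mono ?_
    rintro x ⟨e, i, j, h, hi, hj, rfl⟩
    have he : e < ω + 1 := by
      have : (0 : ℤ) ≤ δ * (i + j) := by positivity
      zify; linarith
    simp only [hS, Finset.coe_image, Set.mem_image, Finset.mem_coe, Finset.mem_product,
      Finset.mem_range]
    exact ⟨(e, i, j), ⟨he, hi, hj⟩, rfl⟩
  have hfin : Module.Finite K (Submodule.span K (S : Set R)) := Module.Finite.span_finset K S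
  refine ⟨Submodule.finiteDimensional_of_le hle, ?_⟩
  refine (Submodule.finrank_mono hle).trans ((finrank_span_finset_le_card S).trans ?_)
  refine Finset.card_image_le.trans ?_
  simp only [Finset.card_product, Finset.card_range]
  exact le_of_eq (by ring)

theorem pow_mem_redSpan {G : K[X][X]} (hm : G.Monic) (hG : WtLE δ G (G.natDegree * δ))
    (h0 : bev (algebraMap K R) v y G = 0) :
    y ^ G.natDegree ∈ redSpan K v y w δ G.natDegree 1 (G.natDegree * δ) := by
  rw [bev_apply, Finset.sum_range_succ, hm.coeff_natDegree, eval₂_one, one_mul] at h0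
  rw [eq_neg_of_add_eq_zero_right h0]
  refine Submodule.neg_mem _ (Submodule.sum_mem _ fun j hj => ?_)
  rw [eval₂_eq_sum_range, Finset.sum_mul]
  refine Submodule.sum_mem _ fun a _ => ?_
  rw [mul_assoc, ← Algebra.smul_def]
  by_cases h : (G.coeff j).coeff a = 0
  · simp [h]
  · refine Submodule.smul_mem _ _ (Submodule.subset_span ⟨a, j, 0, ?_, by simpa using hj, one_pos,
      by simp⟩)
    have := hG _ _ h
    push_cast
    zify at this
    linarith

theorem pow_pred_mem_span {G : K[X][X]} (hm : G.Monic) (hG : WtLE δ G (G.natDegree * δ)) {s : ℕ}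
    (hs : G.natDegree = s + 1)
    (h0 : ∑ j ∈ Finset.range (G.natDegree + 1), (G.coeff j).eval₂ (algebraMap K R) v *
      ∑ i ∈ Finset.range j, w ^ i * y ^ (j - 1 - i) = 0) :
    w ^ s ∈ Submodule.span K {x | ∃ e i j : ℕ, (e : ℤ) + δ * (i + j) ≤ s * δ ∧ j < s ∧
      x = v ^ e * y ^ i * w ^ j} := by
  rw [Finset.sum_range_succ, hm.coeff_natDegree, eval₂_one, one_mul, hs] at h0
  simp only [Nat.add_sub_cancel] at h0
  rw [Finset.sum_range_succ (fun i => w ^ i * y ^ (s - i)), Nat.sub_self, pow_zero, mul_one,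
    ← add_assoc] at h0
  rw [eq_neg_of_add_eq_zero_right h0]
  refine Submodule.neg_mem _ (Submodule.add_mem _ (Submodule.sum_mem _ fun j hj => ?_)
    (Submodule.sum_mem _ fun i hi => ?_))
  · rw [eval₂_eq_sum_range, Finset.sum_mul]
    refine Submodule.sum_mem _ fun a _ => ?_
    rw [mul_assoc, ← Algebra.smul_def]
    by_cases h : (G.coeff j).coeff a = 0
    · simp [h]
    · refine Submodule.smul_mem _ _ ?_
      rw [Finset.mul_sum]
      refine Submodule.sum_mem _ fun i hi => Submodule.subset_span
        ⟨a, j - 1 - i, i, ?_, ?_, by ring⟩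
      · have h1 := hG _ _ h
        rw [hs] at h1
        have hi' : i < j := by simpa using hi
        have : ((j - 1 - i : ℕ) : ℤ) = j - 1 - i := by omega
        rw [this]
        zify at h1
        linarith
      · have hi' : i < j := by simpa using hi
        have hj' : j < s + 1 := by simpa using hj
        omega
  · have hi' : i < s := by simpa using hi
    refine Submodule.subset_span ⟨0, s - i, i, ?_, hi', by ring⟩
    push_cast [hi'.le]
    linarith

end Reduced

section Norm

variable {A S : Type*} [CommRing A] [CommRing S] [IsDomain S] {G : A[X]}

/-- The power basis of `A[X] / (G)` for monic `G`, indexed by `Fin G.natDegree`. -/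
noncomputable def adjBasis (hm : G.Monic) : Module.Basis (Fin G.natDegree) A (AdjoinRoot G) :=
  (AdjoinRoot.powerBasis' hm).basis

theorem adjBasis_apply (hm : G.Monic) (i : Fin G.natDegree) :
    adjBasis hm i = AdjoinRoot.root G ^ (i : ℕ) := by
  have := (AdjoinRoot.powerBasis' hm).basis_eq_pow i
  rwa [AdjoinRoot.powerBasis'_gen] at this

theorem mul_root_pow_eq (hm : G.Monic) (g : AdjoinRoot G) (j : Fin G.natDegree) :
    g * AdjoinRoot.root G ^ (j : ℕ) = ∑ i : Fin G.natDegree,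
      AdjoinRoot.of G (Algebra.leftMulMatrix (adjBasis hm) g i j) *
        AdjoinRoot.root G ^ (i : ℕ) := by
  have h := (adjBasis hm).sum_repr (g * adjBasis hm j)
  rw [adjBasis_apply] at h
  rw [← h]
  refine Finset.sum_congr rfl fun i _ => ?_
  rw [Algebra.leftMulMatrix_eq_repr_mul, adjBasis_apply, adjBasis_apply, Algebra.smul_def,
    AdjoinRoot.algebraMap_eq]

theorem map_norm_eq_prod (hm : G.Monic) (χ : A →+* S) (ψ : Fin G.natDegree → AdjoinRoot G →+* S)
    (hψ : ∀ l, (ψ l).comp (AdjoinRoot.of G) = χ)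
    (hinj : Function.Injective fun l => ψ l (AdjoinRoot.root G)) (g : AdjoinRoot G) :
    χ (Algebra.norm A g) = ∏ l, ψ l g := by
  set V := Matrix.vandermonde fun l => ψ l (AdjoinRoot.root G) with hV
  set M := Algebra.leftMulMatrix (adjBasis hm) g with hM
  have hmul : Matrix.diagonal (fun l => ψ l g) * V = V * χ.mapMatrix M := by
    ext l j
    rw [Matrix.diagonal_mul, Matrix.mul_apply]
    have h := congrArg (ψ l) (mul_root_pow_eq hm g j)
    simp only [map_mul, map_pow, map_sum] at h
    simp only [hV, Matrix.vandermonde_apply, h, RingHom.mapMatrix_apply, Matrix.map_apply]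
    refine Finset.sum_congr rfl fun i _ => ?_
    rw [mul_comm, ← hψ l]
    rfl
  have hdet := congrArg Matrix.det hmul
  rw [Matrix.det_mul, Matrix.det_mul, Matrix.det_diagonal, mul_comm] at hdet
  rw [Algebra.norm_eq_matrix_det (adjBasis hm), RingHom.map_det]
  exact (mul_left_cancel₀ (Matrix.det_vandermonde_ne_zero_iff.2 hinj) hdet).symm

theorem map_norm_eq_zero (hm : G.Monic) (hr : 1 ≤ G.natDegree) (ψ : AdjoinRoot G →+* S)
    {g : AdjoinRoot G} (hg : ψ g = 0) : ψ (AdjoinRoot.of G (Algebra.norm A g)) = 0 := by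
  rw [← RingHom.comp_apply, Algebra.norm_eq_matrix_det (adjBasis hm), RingHom.map_det]
  rw [← Matrix.exists_vecMul_eq_zero_iff]
  refine ⟨fun i => ψ (AdjoinRoot.root G) ^ (i : ℕ), fun h => ?_, ?_⟩
  · have := congrFun h ⟨0, hr⟩
    simp at this
  · ext j
    have h := congrArg ψ (mul_root_pow_eq hm g j)
    simp only [map_mul, map_sum, map_pow, hg, zero_mul] at h
    simp only [Matrix.vecMul, dotProduct, RingHom.mapMatrix_apply, Matrix.map_apply, Pi.zero_apply]
    rw [h]
    refine Finset.sum_congr rfl fun i _ => ?_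
    rw [mul_comm]
    rfl

end Norm

section NormDegree

variable {K : Type*} [Field K] {G : K[X][X]} {δ : ℕ}

theorem bev_root (G P : K[X][X]) :
    bev (algebraMap K (AdjoinRoot G)) (AdjoinRoot.of G X) (AdjoinRoot.root G) P =
      AdjoinRoot.mk G P := by
  have : eval₂RingHom (algebraMap K (AdjoinRoot G)) (AdjoinRoot.of G X) = AdjoinRoot.of G := by
    ext a
    · simp [IsScalarTower.algebraMap_apply K K[X] (AdjoinRoot G)]
    · simp
  rw [bev, this, ← AdjoinRoot.aeval_eq]
  rfl

theorem coeff_repr_of_mem_redSpan (hm : G.Monic) {ω : ℤ} {x : AdjoinRoot G}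
    (hx : x ∈ redSpan K (AdjoinRoot.of G X) (AdjoinRoot.root G) 1 δ G.natDegree 1 ω)
    (i : Fin G.natDegree) (a : ℕ) (h : ((adjBasis hm).repr x i).coeff a ≠ 0) :
    (a : ℤ) + δ * i ≤ ω := by
  unfold redSpan at hx
  contrapose! h
  induction hx using Submodule.span_induction with
  | mem x hx =>
    obtain ⟨e, k, j, h1, hk, hj, rfl⟩ := hx
    have : (AdjoinRoot.of G) X ^ e * AdjoinRoot.root G ^ k * 1 ^ j =
        (X ^ e : K[X]) • adjBasis hm ⟨k, hk⟩ := by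
      rw [adjBasis_apply, Algebra.smul_def, AdjoinRoot.algebraMap_eq, map_pow, one_pow, mul_one]
    rw [this, map_smul, Module.Basis.repr_self, Finsupp.smul_apply, Finsupp.single_apply]
    split_ifs with h2
    · subst h2
      simp only at h
      rw [smul_eq_mul, mul_one, coeff_X_pow, if_neg]
      rintro rfl
      have : (0 : ℤ) ≤ δ * j := by positivity
      linarith
    · simp
  | zero => simp
  | add x y _ _ hx hy => simp [hx, hy]
  | smul c x _ hx =>
    rw [← algebraMap_smul K[X] c x, map_smul, Finsupp.smul_apply]
    simp [hx, Polynomial.algebraMap_eq]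

theorem natDegree_norm_le (hm : G.Monic) (hG : WtLE δ G (G.natDegree * δ)) {ω : ℕ}
    {g : AdjoinRoot G}
    (hg : g ∈ wtSpan K (AdjoinRoot.of G X) (AdjoinRoot.root G) 1 δ ω) :
    (Algebra.norm K[X] g).natDegree ≤ G.natDegree * ω := by
  have hentry : ∀ i j, ∀ a, (Algebra.leftMulMatrix (adjBasis hm) g i j).coeff a ≠ 0 →
      a + δ * (i : ℕ) ≤ ω + δ * (j : ℕ) := by
    intro i j a h
    rw [Algebra.leftMulMatrix_eq_repr_mul] at h
    have h1 : g * adjBasis hm j ∈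
        wtSpan K (AdjoinRoot.of G X) (AdjoinRoot.root G) 1 δ (ω + δ * (j : ℕ)) := by
      rw [adjBasis_apply]
      refine mul_mem_wtSpan hg ?_
      simpa using mem_wtSpan (K := K) (v := AdjoinRoot.of G X) (y := AdjoinRoot.root G) (w := 1)
        (δ := δ) (ω := δ * (j : ℕ)) 0 j 0 (by simp)
    have h2 := wtSpan_le_redSpan (r := G.natDegree) (s := 1)
      (pow_mem_redSpan hm hG (by rw [bev_root, AdjoinRoot.mk_self]))
      (Submodule.subset_span ⟨0, 0, 0, by simp, one_pos, by simp⟩) _ h1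
    have h3 := coeff_repr_of_mem_redSpan hm h2 i a h
    exact_mod_cast h3
  rw [Algebra.norm_eq_matrix_det (adjBasis hm), Matrix.det_apply]
  refine natDegree_sum_le_of_forall_le _ _ fun σ _ => ?_
  refine (natDegree_smul_le _ _).trans ?_
  by_cases h0 : ∏ i, Algebra.leftMulMatrix (adjBasis hm) g (σ i) i = 0
  · simp [h0]
  have h1 : ∀ i, (Algebra.leftMulMatrix (adjBasis hm) g (σ i) i).natDegree + δ * (σ i : ℕ) ≤
      ω + δ * (i : ℕ) := fun i => hentry _ _ _ (by
    rw [coeff_natDegree, Ne, leadingCoeff_eq_zero]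
    exact Finset.prod_ne_zero_iff.1 h0 i (Finset.mem_univ i))
  rw [natDegree_prod _ _ (Finset.prod_ne_zero_iff.1 h0)]
  have h2 := Finset.sum_le_sum fun i (_ : i ∈ Finset.univ) => h1 i
  rw [Finset.sum_add_distrib, Finset.sum_add_distrib,
    Equiv.sum_comp σ (fun i : Fin G.natDegree => δ * (i : ℕ))] at h2
  simpa using h2

end NormDegree

section Points

variable {K : Type*} [Field K]

/-- Pairs of distinct points of the curve `G = 0` with the same first coordinate. -/
structure PairPts (G : K[X][X]) where
  /-- The base coordinate. -/
  v : K
  /-- The first fibre coordinate. -/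
  y : K
  /-- The second fibre coordinate. -/
  w : K
  bev_y : bev (RingHom.id K) v y G = 0
  bev_w : bev (RingHom.id K) v w G = 0
  y_ne_w : y ≠ w

namespace PairPts

variable {G : K[X][X]} {δ : ℕ}

theorem bev_eval (v' y' : PairPts G → K) (H : K[X][X]) (P : PairPts G) :
    bev (algebraMap K (PairPts G → K)) v' y' H P = bev (RingHom.id K) (v' P) (y' P) H :=
  map_bev (Pi.evalRingHom (fun _ => K) P) _ _ _ _

theorem bev_self : bev (algebraMap K (PairPts G → K)) v y G = 0 := by
  ext P
  rw [bev_eval]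
  exact P.bev_y

theorem sum_eq_zero :
    ∑ j ∈ Finset.range (G.natDegree + 1), (G.coeff j).eval₂ (algebraMap K (PairPts G → K)) v *
      ∑ i ∈ Finset.range j, w ^ i * y ^ (j - 1 - i) = 0 := by
  ext P
  rw [Finset.sum_apply]
  refine mul_left_cancel₀ (sub_ne_zero.2 P.y_ne_w) ?_
  rw [Pi.zero_apply, mul_zero, Finset.mul_sum]
  have h0 : bev (RingHom.id K) P.v P.y G - bev (RingHom.id K) P.v P.w G = 0 := by
    rw [P.bev_y, P.bev_w, sub_zero]
  rw [← h0, bev_apply, bev_apply, ← Finset.sum_sub_distrib]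
  refine Finset.sum_congr rfl fun j _ => ?_
  have h1 : (G.coeff j).eval₂ (algebraMap K (PairPts G → K)) v P =
      (G.coeff j).eval₂ (RingHom.id K) P.v :=
    hom_eval₂ (G.coeff j) (algebraMap K (PairPts G → K)) (Pi.evalRingHom (fun _ => K) P) v
  have h2 := geom_sum₂_mul P.w P.y j
  rw [Pi.mul_apply, h1, ← mul_sub, Finset.sum_apply]
  simp only [Pi.mul_apply, Pi.pow_apply]
  linear_combination (-(G.coeff j).eval₂ (RingHom.id K) P.v) * h2

/-- The partial derivative with respect to the fibre coordinate. -/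
noncomputable def f (P : PairPts G) : K := bev (RingHom.id K) P.v P.y (derivative G)

theorem f_eq : (f : PairPts G → K) = bev (algebraMap K (PairPts G → K)) v y (derivative G) := by
  ext P
  rw [bev_eval, f]

/-- The function ring on `PairPts G` has small filtered pieces. -/
theorem finrank_wtSpan_le (hm : G.Monic) (hG : WtLE δ G (G.natDegree * δ)) {s : ℕ}
    (hs : G.natDegree = s + 1) (ω : ℕ) :
    Module.Finite K (wtSpan K (v : PairPts G → K) y w δ ω) ∧
      Module.finrank K (wtSpan K (v : PairPts G → K) y w δ ω) ≤ G.natDegree * s * (ω + 1) := by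
  have hle := wtSpan_le_redSpan (pow_mem_redSpan (w := w) hm hG bev_self)
    (pow_pred_mem_span hm hG hs sum_eq_zero) ω
  obtain ⟨h1, h2⟩ := finrank_redSpan_le (K := K) (v := (v : PairPts G → K)) (y := y) (w := w)
    (δ := δ) G.natDegree s ω
  exact ⟨Submodule.finiteDimensional_of_le hle, (Submodule.finrank_mono hle).trans h2⟩

theorem exists_expansion (hr : 1 ≤ G.natDegree) (hG : WtLE δ G (G.natDegree * δ)) {φ : ℤ}
    (hφ : φ = (G.natDegree - 1) * δ) :
    ∃ Θ : AdjoinRoot G →+* PowerSeries (PairPts G → K),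
      (∀ c : K, Θ (AdjoinRoot.of G (C c)) = PowerSeries.C (algebraMap K _ c)) ∧
      Θ (AdjoinRoot.of G X) = PowerSeries.C v + PowerSeries.C (f ^ 2) * PowerSeries.X ∧
      PowerSeries.constantCoeff (Θ (AdjoinRoot.root G)) = y ∧
      ∀ a i : ℕ, Θ (AdjoinRoot.of G X ^ a * AdjoinRoot.root G ^ i) ∈
        wtSeries K v y w δ (2 * φ) (a + i * δ) := by
  obtain ⟨z, hXz, hz, h0⟩ := exists_taylor (w := w) hr hG bev_self f_eq hφ
  refine ⟨AdjoinRoot.lift (eval₂RingHom (PowerSeries.C.comp (algebraMap K _))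
    (PowerSeries.C v + PowerSeries.C (f ^ 2) * PowerSeries.X)) _ h0, ?_, ?_, ?_, ?_⟩
  · intro c
    simp
  · simp
  · simp [PowerSeries.X_dvd_iff.1 hXz]
  · intro a i
    convert hz a i using 1
    simp

end PairPts

/-- Taylor expansion of a polynomial at `c`, as a power series. -/
noncomputable def taylorSeries (c : K) : K[X] →+* PowerSeries K :=
  eval₂RingHom PowerSeries.C (PowerSeries.C c + PowerSeries.X)

theorem taylorSeries_eq (c : K) (h : K[X]) : taylorSeries c h = (taylor c h : PowerSeries K) := by
  have : taylorSeries c = (coeToPowerSeries.ringHom).comp (taylorAlgHom c : K[X] →+* K[X]) := by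
    ext <;> simp [taylorSeries, add_comm]
  rw [this]
  simp

theorem X_sub_C_pow_dvd_of_taylorSeries {c : K} {h : K[X]} {N : ℕ}
    (hd : PowerSeries.X ^ N ∣ taylorSeries c h) : (X - C c) ^ N ∣ h := by
  rw [taylorSeries_eq, PowerSeries.X_pow_dvd_iff] at hd
  rw [X_sub_C_pow_dvd_iff, X_pow_dvd_iff]
  intro d hN
  have := hd d hN
  rw [coeff_coe] at this
  rwa [taylor_apply] at this

theorem PowerSeries.rescale_C' {R : Type*} [CommRing R] (a c : R) :
    PowerSeries.rescale a (PowerSeries.C c) = PowerSeries.C c := by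
  ext m
  rw [PowerSeries.coeff_rescale, PowerSeries.coeff_C]
  split_ifs with h <;> simp [h]

/-- The expansion at a single point, in the local coordinate `v - v₀`. -/
theorem exists_point_expansion {G : K[X][X]}
    (Θ : AdjoinRoot G →+* PowerSeries (PairPts G → K))
    (hΘC : ∀ c : K, Θ (AdjoinRoot.of G (C c)) = PowerSeries.C (algebraMap K _ c))
    (hΘX : Θ (AdjoinRoot.of G X) = PowerSeries.C PairPts.v +
      PowerSeries.C (PairPts.f ^ 2) * PowerSeries.X)
    (hΘY : PowerSeries.constantCoeff (Θ (AdjoinRoot.root G)) = PairPts.y)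
    (P : PairPts G) (hP : P.f ≠ 0) :
    ∃ ψ : AdjoinRoot G →+* PowerSeries K, ψ.comp (AdjoinRoot.of G) = taylorSeries P.v ∧
      PowerSeries.constantCoeff (ψ (AdjoinRoot.root G)) = P.y ∧
      ∀ m x, PowerSeries.coeff m (ψ x) = (P.f ^ 2)⁻¹ ^ m * PowerSeries.coeff m (Θ x) P := by
  have hcoeff : ∀ m x, PowerSeries.coeff m ((((PowerSeries.rescale (P.f ^ 2)⁻¹).comp
      (PowerSeries.map (Pi.evalRingHom (fun _ => K) P))).comp Θ) x) =
      (P.f ^ 2)⁻¹ ^ m * PowerSeries.coeff m (Θ x) P := by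
    intro m x
    simp [PowerSeries.coeff_rescale]
  refine ⟨((PowerSeries.rescale (P.f ^ 2)⁻¹).comp
    (PowerSeries.map (Pi.evalRingHom (fun _ => K) P))).comp Θ, ?_, ?_, hcoeff⟩
  · refine Polynomial.ringHom_ext (fun c => ?_) ?_
    · simp [hΘC, taylorSeries, PowerSeries.rescale_C']
    · simp only [RingHom.comp_apply, hΘX, taylorSeries, coe_eval₂RingHom, eval₂_X, map_add,
        map_mul, PowerSeries.map_C, PowerSeries.map_X, PowerSeries.rescale_C',
        PowerSeries.rescale_X, Pi.evalRingHom_apply, Pi.pow_apply]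
      rw [← mul_assoc, ← map_mul PowerSeries.C, mul_inv_cancel₀ (pow_ne_zero 2 hP), map_one,
        one_mul]
  · rw [← PowerSeries.coeff_zero_eq_constantCoeff_apply, hcoeff,
      PowerSeries.coeff_zero_eq_constantCoeff_apply, hΘY]
    simp

end Points

theorem exists_ne_zero_sum_smul_eq_zero {K E ι : Type*} [Field K] [AddCommGroup E] [Module K E]
    [Fintype ι] {M : ℕ} (W : Fin M → Submodule K E) (d : Fin M → ℕ) (u : Fin M → ι → E)
    (hu : ∀ m i, u m i ∈ W m) (hW : ∀ m, Module.Finite K (W m))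
    (hd : ∀ m, Module.finrank K (W m) ≤ d m) (hcard : ∑ m, d m < Fintype.card ι) :
    ∃ c : ι → K, c ≠ 0 ∧ ∀ m, ∑ i, c i • u m i = 0 := by
  let D : (ι → K) →ₗ[K] (∀ m, W m) := LinearMap.pi fun m =>
    Fintype.linearCombination K fun i => (⟨u m i, hu m i⟩ : W m)
  have h1 : Module.finrank K (∀ m, W m) < Module.finrank K (ι → K) := by
    rw [Module.finrank_pi_fintype, Module.finrank_fintype_fun_eq_card]
    exact (Finset.sum_le_sum fun m _ => hd m).trans_lt hcard
  obtain ⟨c, hc, hc0⟩ := Submodule.exists_mem_ne_zero_of_ne_bot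
    (LinearMap.ker_ne_bot_of_finrank_lt h1 (f := D))
  refine ⟨c, hc0, fun m => ?_⟩
  have := congrArg (fun x => ((x m : W m) : E)) (LinearMap.mem_ker.1 hc)
  simpa [D, Fintype.linearCombination_apply] using this

theorem PowerSeries.X_pow_dvd_pow_sub {K : Type*} [Field K] (p e : ℕ) [Fact p.Prime] [CharP K p]
    (x : PowerSeries K) :
    (X : PowerSeries K) ^ p ^ e ∣ x ^ p ^ e - C (constantCoeff x ^ p ^ e) := by
  have : CharP (PowerSeries K) p := charP_of_injective_ringHom PowerSeries.C_injective p
  rw [map_pow, ← sub_pow_char_pow]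
  exact pow_dvd_pow_of_dvd (X_dvd_iff.2 (by simp)) _

section Lin

variable {K : Type*} [Field K] {G : K[X][X]} {δ α : ℕ}

/-- The element of `K[X][X] / (G)` with given coefficients on the monomials `v ^ a * y ^ i`. -/
noncomputable def linElt (d : Fin α × Fin G.natDegree → K) : AdjoinRoot G :=
  ∑ x, AdjoinRoot.of G (C (d x)) * (AdjoinRoot.of G X ^ (x.1 : ℕ) * AdjoinRoot.root G ^ (x.2 : ℕ))

theorem of_C_mul (c : K) (x : AdjoinRoot G) : AdjoinRoot.of G (C c) * x = c • x := by
  rw [Algebra.smul_def, IsScalarTower.algebraMap_apply K K[X] (AdjoinRoot G)]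
  rfl

theorem linElt_mem (d : Fin α × Fin G.natDegree → K) {ω : ℕ}
    (h : α + (G.natDegree - 1) * δ ≤ ω + 1) :
    linElt d ∈ wtSpan K (AdjoinRoot.of G X) (AdjoinRoot.root G) 1 δ ω := by
  refine Submodule.sum_mem _ fun x _ => ?_
  rw [of_C_mul]
  refine Submodule.smul_mem _ _ ?_
  have := mem_wtSpan (K := K) (v := AdjoinRoot.of G X) (y := AdjoinRoot.root G) (w := 1)
    (δ := δ) (ω := ω) x.1 x.2 0 (by
      have h1 := x.1.2
      have h2 : (x.2 : ℕ) * δ ≤ (G.natDegree - 1) * δ :=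
        Nat.mul_le_mul_right _ (by have := x.2.2; omega)
      have h3 : (x.1 : ℕ) + (x.2 : ℕ) * δ ≤ ω := by omega
      push_cast
      zify at h3
      linarith)
  simpa using this

theorem linElt_ne_zero (hm : G.Monic) {d : Fin α × Fin G.natDegree → K} (hd : d ≠ 0) :
    linElt d ≠ 0 := by
  contrapose! hd
  have h1 : ∑ i, (∑ a : Fin α, C (d (a, i)) * X ^ (a : ℕ)) • adjBasis hm i = 0 := by
    rw [← hd, linElt, Fintype.sum_prod_type_right]
    refine Finset.sum_congr rfl fun i _ => ?_
    rw [adjBasis_apply, Finset.sum_smul]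
    refine Finset.sum_congr rfl fun a _ => ?_
    rw [Algebra.smul_def, AdjoinRoot.algebraMap_eq, map_mul, map_pow, mul_assoc]
  have h2 := Fintype.linearIndependent_iff.1 (adjBasis hm).linearIndependent _ h1
  ext ⟨a, i⟩
  have h3 := congrArg (fun P => coeff P (a : ℕ)) (h2 i)
  simp only [finsetSum_coeff, coeff_C_mul, coeff_X_pow, coeff_zero] at h3
  rw [Finset.sum_eq_single a] at h3
  · simpa using h3
  · intro b _ hb
    rw [if_neg (fun h => hb (Fin.ext h.symm)), mul_zero]
  · simp

theorem map_linElt {S : Type*} [CommRing S] (ψ : AdjoinRoot G →+* S)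
    (d : Fin α × Fin G.natDegree → K) :
    ψ (linElt d) = ∑ x, ψ (AdjoinRoot.of G (C (d x))) *
      ψ (AdjoinRoot.of G X ^ (x.1 : ℕ) * AdjoinRoot.root G ^ (x.2 : ℕ)) := by
  simp [linElt]

end Lin

section Fibre

variable {K : Type*} [Field K] {G : K[X][X]}

theorem bev_id_eq_eval (v y : K) (P : K[X][X]) :
    bev (RingHom.id K) v y P = (P.map (evalRingHom v)).eval y := by
  rw [bev, eval_map]
  rfl

/-- A fibre where the discriminant does not vanish consists of `G.natDegree` distinct points. -/
theorem exists_fibre [IsAlgClosed K] (hm : G.Monic) (hr : 1 ≤ G.natDegree) {v : K}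
    (hv : (Algebra.norm K[X] (AdjoinRoot.mk G (derivative G))).eval v ≠ 0) :
    (∃ y : Fin G.natDegree → K, Function.Injective y ∧ ∀ l, bev (RingHom.id K) v (y l) G = 0) ∧
      ∀ y, bev (RingHom.id K) v y G = 0 → bev (RingHom.id K) v y (derivative G) ≠ 0 := by
  have hsep : ∀ y, bev (RingHom.id K) v y G = 0 →
      bev (RingHom.id K) v y (derivative G) ≠ 0 := by
    intro y hy h0
    apply hv
    have hy' : eval₂ (eval₂RingHom (RingHom.id K) v) y G = 0 := hy
    have h1 := map_norm_eq_zero hm hr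
      (ψ := AdjoinRoot.lift (eval₂RingHom (RingHom.id K) v) y hy')
      (g := AdjoinRoot.mk G (derivative G)) (by rw [AdjoinRoot.lift_mk]; exact h0)
    rw [AdjoinRoot.lift_of] at h1
    exact h1
  refine ⟨?_, hsep⟩
  classical
  set g := G.map (evalRingHom v) with hg
  have hgm : g.Monic := hm.map _
  have hdeg : g.natDegree = G.natDegree := hm.natDegree_map _
  have hnodup : g.roots.Nodup := by
    rw [Multiset.nodup_iff_count_le_one]
    intro y
    rw [count_roots]
    by_contra! hlt
    have h2 := (one_lt_rootMultiplicity_iff_isRoot hgm.ne_zero).1 hlt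
    refine hsep y ?_ ?_
    · rw [bev_id_eq_eval]; exact h2.1
    · rw [bev_id_eq_eval, ← derivative_map]; exact h2.2
  have hcard : Multiset.card g.roots = G.natDegree := by
    rw [← hdeg]
    exact (IsAlgClosed.splits g).natDegree_eq_card_roots.symm
  have hcard' : (⟨g.roots, hnodup⟩ : Finset K).card = G.natDegree := hcard
  let eqv := (Finset.equivFinOfCardEq hcard').symm
  refine ⟨fun l => eqv l, fun a b h => eqv.injective (Subtype.ext h), fun l => ?_⟩
  have : (eqv l : K) ∈ g.roots := (eqv l).2
  rw [bev_id_eq_eval]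
  exact (mem_roots'.1 this).2

end Fibre

section Auxiliary

variable {K : Type*} [Field K] {G : K[X][X]}

/-- The auxiliary function
`∑ x, v ^ x.1 * y ^ x.2 * (∑ x', d (x, x') * v ^ x'.1 * y ^ x'.2) ^ q`. -/
noncomputable def auxElt {α β : ℕ} (q : ℕ)
    (d : Fin α × Fin G.natDegree → Fin β × Fin G.natDegree → K) : AdjoinRoot G :=
  ∑ x, AdjoinRoot.of G X ^ (x.1 : ℕ) * AdjoinRoot.root G ^ (x.2 : ℕ) * linElt (d x) ^ q

variable {α β δ : ℕ}

theorem auxElt_mem {q ω₁ ω₂ : ℕ} (d : Fin α × Fin G.natDegree → Fin β × Fin G.natDegree → K)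
    (h₁ : α + (G.natDegree - 1) * δ ≤ ω₁ + 1) (h₂ : β + (G.natDegree - 1) * δ ≤ ω₂ + 1) :
    auxElt q d ∈ wtSpan K (AdjoinRoot.of G X) (AdjoinRoot.root G) 1 δ (ω₁ + q * ω₂ : ℕ) := by
  refine Submodule.sum_mem _ fun x _ => ?_
  push_cast
  refine mul_mem_wtSpan ?_ (pow_mem_wtSpan (linElt_mem (d x) h₂) q)
  have := linElt_mem (G := G) (Pi.single x (1 : K)) h₁
  rw [linElt, Finset.sum_eq_single x] at this
  · simpa using this
  · intro x' _ hx'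
    simp [hx']
  · simp

/-- Modulo `s ^ q` the expansion of the auxiliary function is linear over constants. -/
theorem X_pow_dvd_auxElt_sub (p e : ℕ) [Fact p.Prime] [CharP K p]
    (ψ : AdjoinRoot G →+* PowerSeries K) (hC : ∀ c, ψ (AdjoinRoot.of G (C c)) = PowerSeries.C c)
    (d : Fin α × Fin G.natDegree → Fin β × Fin G.natDegree → K) :
    PowerSeries.X ^ p ^ e ∣ ψ (auxElt (p ^ e) d) -
      ψ (linElt fun x => PowerSeries.constantCoeff (ψ (linElt (d x))) ^ p ^ e) := by
  rw [map_linElt, auxElt, map_sum, ← Finset.sum_sub_distrib]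
  refine Finset.dvd_sum fun x _ => ?_
  rw [hC, map_mul, mul_comm, ← sub_mul, map_pow]
  exact (PowerSeries.X_pow_dvd_pow_sub p e _).mul_right _

end Auxiliary

section Expansion

variable {K : Type*} [Field K] {G : K[X][X]}

/-- A system of compatible expansions of the function ring of `G = 0` at pairs of points, together
with vanishing conditions: the content of the Taylor construction in usable form. -/
theorem exists_coefficients [IsAlgClosed K] (p e : ℕ) [Fact p.Prime] [CharP K p] {δ s M α β : ℕ}
    (hm : G.Monic) (hG : WtLE δ G (G.natDegree * δ)) (hs : G.natDegree = s + 1)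
    (hαβ : 1 ≤ α) (hβ : 1 ≤ β)
    (hcount : G.natDegree * s * (M * (α + β + s * δ) + s * δ * M ^ 2) <
      α * G.natDegree * (β * G.natDegree)) :
    ∃ (ψ : ∀ P : PairPts G, P.f ≠ 0 → AdjoinRoot G →+* PowerSeries K)
      (d : Fin α × Fin G.natDegree → Fin β × Fin G.natDegree → K),
      (∀ P hP, (ψ P hP).comp (AdjoinRoot.of G) = taylorSeries P.v ∧
        PowerSeries.constantCoeff (ψ P hP (AdjoinRoot.root G)) = P.y) ∧ d ≠ 0 ∧
      ∀ P hP, P.v ^ p ^ e = P.v → P.y ^ p ^ e = P.w → M ≤ p ^ e →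
        PowerSeries.X ^ M ∣ ψ P hP (auxElt (p ^ e) d) := by
  obtain ⟨Θ, hΘC, hΘX, hΘY, hΘ⟩ := PairPts.exists_expansion (by omega) hG rfl
  set φ : ℕ := s * δ with hφ
  have hφ' : ((G.natDegree : ℤ) - 1) * δ = (φ : ℕ) := by rw [hs, hφ]; push_cast; ring
  rw [hφ'] at hΘ
  let ωf : ℕ → ℕ := fun m => α + β - 2 + 2 * φ + m * (2 * φ)
  let u : Fin M → (Fin α × Fin G.natDegree) × (Fin β × Fin G.natDegree) → (PairPts G → K) :=
    fun m x => PowerSeries.coeff (m : ℕ)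
      (Θ (AdjoinRoot.of G X ^ (x.1.1 : ℕ) * AdjoinRoot.root G ^ (x.1.2 : ℕ))) *
        (PairPts.v ^ (x.2.1 : ℕ) * PairPts.y ^ 0 * PairPts.w ^ (x.2.2 : ℕ))
  obtain ⟨c, hc0, hc⟩ := exists_ne_zero_sum_smul_eq_zero
    (fun m : Fin M => wtSpan K (PairPts.v : PairPts G → K) PairPts.y PairPts.w δ (ωf m))
    (fun m => G.natDegree * s * (ωf m + 1)) u (by
      rintro m ⟨⟨a, i⟩, b, j⟩
      have h1 := hΘ a i m
      have h2 := mem_wtSpan (K := K) (v := (PairPts.v : PairPts G → K)) (y := PairPts.y)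
        (w := PairPts.w) (δ := δ) (ω := (b : ℤ) + δ * (j : ℕ)) b 0 j (by simp)
      refine wtSpan_mono ?_ (mul_mem_wtSpan h1 h2)
      have hi : (i : ℕ) * δ ≤ φ := Nat.mul_le_mul_right _ (by have := i.2; omega)
      have hj : (j : ℕ) * δ ≤ φ := Nat.mul_le_mul_right _ (by have := j.2; omega)
      have h3 : (a : ℕ) + (i : ℕ) * δ + m * (2 * φ) + (b + j * δ) ≤ ωf m := by
        have := a.2
        have := b.2
        simp only [ωf]
        omega
      zify at h3
      linarith)
    (fun m => (PairPts.finrank_wtSpan_le hm hG hs (ωf m)).1)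
    (fun m => (PairPts.finrank_wtSpan_le hm hG hs (ωf m)).2) (by
      simp only [Fintype.card_prod, Fintype.card_fin]
      refine lt_of_le_of_lt ?_ hcount
      rw [← Finset.mul_sum, Fin.sum_univ_eq_sum_range (fun m => ωf m + 1)]
      refine Nat.mul_le_mul_left _ ?_
      have h1 : ∑ m ∈ Finset.range M, (ωf m + 1) ≤
          ∑ m ∈ Finset.range M, (α + β + 2 * φ + m * (2 * φ)) - M := by
        rw [Nat.le_sub_iff_add_le]
        · have : M = ∑ m ∈ Finset.range M, 1 := by simp
          nth_rewrite 2 [this]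
          rw [← Finset.sum_add_distrib]
          refine Finset.sum_le_sum fun m _ => ?_
          simp only [ωf]
          omega
        · have : M = ∑ m ∈ Finset.range M, 1 := by simp
          nth_rewrite 1 [this]
          refine Finset.sum_le_sum fun m _ => by omega
      refine h1.trans ?_
      rw [Finset.sum_add_distrib, ← Finset.sum_mul,
        ← mul_assoc (∑ i ∈ Finset.range M, i) 2 φ, Finset.sum_range_id_mul_two]
      simp only [Finset.sum_const, Finset.card_range, smul_eq_mul]
      rcases M with _ | M
      · simp
      · simp only [Nat.add_sub_cancel]
        refine (Nat.sub_le _ _).trans ?_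
        nlinarith)
  choose ψ hψ1 hψ2 hψ3 using fun (P : PairPts G) (hP : P.f ≠ 0) =>
    exists_point_expansion Θ hΘC hΘX hΘY P hP
  have hp : 0 < p ^ e := pow_pos (Fact.out : p.Prime).pos e
  choose d hd using fun x => IsAlgClosed.exists_pow_nat_eq (c x) hp
  refine ⟨ψ, fun x x' => d (x, x'), fun P hP => ⟨hψ1 P hP, hψ2 P hP⟩, ?_, ?_⟩
  · intro h
    apply hc0
    ext ⟨x, x'⟩
    rw [← hd, congrFun (congrFun h x) x']
    rw [Pi.zero_apply, Pi.zero_apply, zero_pow hp.ne', Pi.zero_apply]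
  · intro P hP hv hy hM
    have hC : ∀ c, ψ P hP (AdjoinRoot.of G (C c)) = PowerSeries.C c := by
      intro c
      rw [← RingHom.comp_apply, hψ1 P hP]
      simp [taylorSeries]
    refine (dvd_iff_dvd_of_dvd_sub
      ((pow_dvd_pow _ hM).trans (X_pow_dvd_auxElt_sub p e (ψ P hP) hC _))).2 ?_
    rw [PowerSeries.X_pow_dvd_iff]
    intro m hm
    have hval : ∀ x, PowerSeries.constantCoeff (ψ P hP (linElt fun x' => d (x, x'))) ^ p ^ e =
        ∑ x' : Fin β × Fin G.natDegree,
          c (x, x') * (P.v ^ (x'.1 : ℕ) * P.w ^ (x'.2 : ℕ)) := by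
      intro x
      rw [map_linElt, map_sum, sum_pow_char_pow]
      refine Finset.sum_congr rfl fun x' _ => ?_
      have hX : PowerSeries.constantCoeff (ψ P hP (AdjoinRoot.of G X)) = P.v := by
        rw [← RingHom.comp_apply (ψ P hP), hψ1 P hP]
        simp [taylorSeries]
      simp only [map_mul, map_pow, hC, hψ2 P hP, hX, PowerSeries.constantCoeff_C, mul_pow]
      rw [hd, ← pow_mul, ← pow_mul, mul_comm _ (p ^ e), mul_comm _ (p ^ e), pow_mul, pow_mul,
        hv, hy]
    rw [map_linElt, map_sum]
    have hz := congrFun (hc ⟨m, hm⟩) P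
    rw [Finset.sum_apply, Fintype.sum_prod_type] at hz
    refine Eq.trans ?_ ((congrArg (fun t => (P.f ^ 2)⁻¹ ^ m * t) hz).trans (mul_zero _))
    simp only [Finset.mul_sum]
    refine Finset.sum_congr rfl fun x _ => ?_
    rw [hC, PowerSeries.coeff_C_mul, hψ3 P hP, hval, Finset.sum_mul]
    refine Finset.sum_congr rfl fun x' _ => ?_
    simp only [u, Pi.smul_apply, Pi.mul_apply, Pi.pow_apply, smul_eq_mul, pow_zero, Pi.one_apply]
    ring

end Expansion

section NonVanishing

variable {K : Type*} [Field K] {G : K[X][X]}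

theorem norm_ne_zero_of_irreducible (hm : G.Monic) (hirr : Irreducible G) {g : AdjoinRoot G}
    (hg : g ≠ 0) : Algebra.norm K[X] g ≠ 0 := by
  have : IsDomain (AdjoinRoot G) := AdjoinRoot.isDomain_of_prime hirr.prime
  have : Module.Free K[X] (AdjoinRoot G) := Module.Free.of_basis (adjBasis hm)
  have : Module.Finite K[X] (AdjoinRoot G) := Module.Finite.of_basis (adjBasis hm)
  exact Algebra.norm_ne_zero_iff.2 hg

theorem mk_derivative_ne_zero (hm : G.Monic) (h : derivative G ≠ 0) :
    AdjoinRoot.mk G (derivative G) ≠ 0 := by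
  rw [Ne, AdjoinRoot.mk_eq_zero]
  intro hd
  refine h (eq_zero_of_dvd_of_degree_lt hd ?_)
  exact degree_derivative_lt hm.ne_zero

/-- Vanishing of a function at all points of a fibre makes its norm vanish. -/
theorem X_sub_C_pow_dvd_norm (hm : G.Monic) {v : K} {y : Fin G.natDegree → K}
    (hy : Function.Injective y) (ψ : Fin G.natDegree → AdjoinRoot G →+* PowerSeries K)
    (hψ : ∀ l, (ψ l).comp (AdjoinRoot.of G) = taylorSeries v)
    (hψy : ∀ l, PowerSeries.constantCoeff (ψ l (AdjoinRoot.root G)) = y l)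
    {g : AdjoinRoot G} {N : Fin G.natDegree → ℕ} (hN : ∀ l, PowerSeries.X ^ N l ∣ ψ l g) :
    (X - C v) ^ (∑ l, N l) ∣ Algebra.norm K[X] g := by
  apply X_sub_C_pow_dvd_of_taylorSeries
  rw [map_norm_eq_prod hm (taylorSeries v) ψ hψ, ← Finset.prod_pow_eq_pow_sum]
  · exact Finset.prod_dvd_prod_of_dvd _ _ fun l _ => hN l
  · intro a b h
    apply hy
    rw [← hψy a, ← hψy b]
    exact congrArg _ h

theorem constantCoeff_taylorSeries (c : K) (h : K[X]) :
    PowerSeries.constantCoeff (taylorSeries c h) = h.eval c := by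
  rw [taylorSeries_eq]
  simp [constantCoeff_coe, taylor_coeff_zero]

theorem auxElt_ne_zero [IsAlgClosed K] (p e : ℕ) [Fact p.Prime] [CharP K p] {δ α β ω : ℕ}
    (hm : G.Monic) (hirr : Irreducible G) (hr : 2 ≤ G.natDegree)
    (hG : WtLE δ G (G.natDegree * δ)) (hder : derivative G ≠ 0)
    (hω : α + (G.natDegree - 1) * δ ≤ ω + 1) (hq : G.natDegree * ω < p ^ e)
    (ψ : ∀ P : PairPts G, P.f ≠ 0 → AdjoinRoot G →+* PowerSeries K)
    (hψ : ∀ P hP, (ψ P hP).comp (AdjoinRoot.of G) = taylorSeries P.v ∧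
      PowerSeries.constantCoeff (ψ P hP (AdjoinRoot.root G)) = P.y)
    {d : Fin α × Fin G.natDegree → Fin β × Fin G.natDegree → K} (hd : d ≠ 0) :
    auxElt (p ^ e) d ≠ 0 := by
  intro h0
  obtain ⟨x, hx⟩ := Function.ne_iff.1 hd
  have hH : Algebra.norm K[X] (linElt (d x)) ≠ 0 :=
    norm_ne_zero_of_irreducible hm hirr (linElt_ne_zero hm hx)
  have hf := norm_ne_zero_of_irreducible hm hirr (mk_derivative_ne_zero hm hder)
  obtain ⟨v, hv⟩ : ∃ v, (Algebra.norm K[X] (linElt (d x)) *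
      Algebra.norm K[X] (AdjoinRoot.mk G (derivative G))).eval v ≠ 0 := by
    by_contra! h
    have : Infinite K := IsAlgClosed.instInfinite
    exact mul_ne_zero hH hf (Polynomial.funext fun v => by rw [h v, eval_zero])
  rw [eval_mul] at hv
  obtain ⟨⟨y, hyi, hy⟩, hsep⟩ := exists_fibre hm (by omega) (right_ne_zero_of_mul hv)
  have hnt : Nontrivial (Fin G.natDegree) := Fin.nontrivial_iff_two_le.2 hr
  choose l' hl' using fun l : Fin G.natDegree => exists_ne l
  let P : Fin G.natDegree → PairPts G := fun l =>
    ⟨v, y l, y (l' l), hy l, hy _, fun h => hl' l (hyi h).symm⟩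
  have hP : ∀ l, (P l).f ≠ 0 := fun l => hsep _ (hy l)
  let g : AdjoinRoot G := linElt fun x' =>
    PowerSeries.constantCoeff (ψ (P ⟨0, by omega⟩) (hP _) (linElt (d x'))) ^ p ^ e
  have hg : g ≠ 0 := by
    refine linElt_ne_zero hm (Function.ne_iff.2 ⟨x, pow_ne_zero _ fun h => ?_⟩)
    have h1 := map_norm_eq_zero hm (by omega)
      (PowerSeries.constantCoeff.comp (ψ (P ⟨0, by omega⟩) (hP _))) h
    rw [RingHom.comp_apply, ← RingHom.comp_apply (ψ _ _), (hψ _ _).1,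
      constantCoeff_taylorSeries] at h1
    exact left_ne_zero_of_mul hv h1
  have hC : ∀ c, ψ (P ⟨0, by omega⟩) (hP _) (AdjoinRoot.of G (C c)) = PowerSeries.C c := by
    intro c
    rw [← RingHom.comp_apply, (hψ _ _).1]
    simp [taylorSeries]
  have hXg : PowerSeries.X ^ p ^ e ∣ ψ (P ⟨0, by omega⟩) (hP _) g := by
    have := X_pow_dvd_auxElt_sub p e _ hC d
    rwa [h0, map_zero, zero_sub, dvd_neg] at this
  have hdvd := X_sub_C_pow_dvd_norm hm hyi (fun l => ψ (P l) (hP l)) (fun l => (hψ _ _).1)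
    (fun l => (hψ _ _).2) (g := g) (N := Pi.single ⟨0, by omega⟩ (p ^ e)) (by
      intro l
      by_cases hl : l = ⟨0, by omega⟩
      · subst hl
        simpa using hXg
      · simp [Pi.single_eq_of_ne hl])
  rw [Finset.sum_pi_single' , if_pos (Finset.mem_univ _)] at hdvd
  have h1 := natDegree_le_of_dvd hdvd (norm_ne_zero_of_irreducible hm hirr hg)
  rw [natDegree_pow, natDegree_X_sub_C, mul_one] at h1
  exact absurd (h1.trans (natDegree_norm_le hm hG (linElt_mem _ hω))) (by omega)

end NonVanishing

section RationalPoints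

variable {K : Type*} [Field K] {G : K[X][X]}

theorem bev_pow (p e : ℕ) [Fact p.Prime] [CharP K p]
    (hfix : ∀ j a, ((G.coeff j).coeff a) ^ p ^ e = (G.coeff j).coeff a) (v y : K) :
    bev (RingHom.id K) (v ^ p ^ e) (y ^ p ^ e) G = bev (RingHom.id K) v y G ^ p ^ e := by
  rw [← iterateFrobenius_def p e (bev _ _ _ _), map_bev, bev_apply, bev_apply]
  refine Finset.sum_congr rfl fun j _ => ?_
  rw [iterateFrobenius_def, iterateFrobenius_def, eval₂_eq_sum_range, eval₂_eq_sum_range]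
  congr 1
  refine Finset.sum_congr rfl fun a _ => ?_
  simp [iterateFrobenius_def, hfix]

theorem card_roots_X_pow_sub_X [IsAlgClosed K] [DecidableEq K] (p e : ℕ) [Fact p.Prime]
    [CharP K p] (he : e ≠ 0) : (X ^ p ^ e - X : K[X]).roots.toFinset.card = p ^ e := by
  have hsep : (X ^ p ^ e - X : K[X]).Separable := galois_poly_separable p _ (dvd_pow_self p he)
  rw [Multiset.toFinset_card_of_nodup (nodup_roots hsep),
    ← (IsAlgClosed.splits (X ^ p ^ e - X : K[X])).natDegree_eq_card_roots]
  exact FiniteField.X_pow_card_pow_sub_X_natDegree_eq K he (Fact.out : p.Prime).one_lt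

theorem count_inequality {n s δ : ℕ} (hs1 : 1 ≤ s) (hsn : s + 1 ≤ n) (hδ : (s + 1) * δ ≤ n ^ 3)
    (hn : 5 ≤ n) :
    (s + 1) * s * (2 * n * n ^ 3 * (4 * n ^ 2 * n ^ 6 + (2 * n - 1) * n ^ 3 + s * δ) +
        s * δ * (2 * n * n ^ 3) ^ 2) <
      4 * n ^ 2 * n ^ 6 * (s + 1) * ((2 * n - 1) * n ^ 3 * (s + 1)) := by
  obtain ⟨t, rfl⟩ : ∃ t, n = s + 1 + t := Nat.exists_eq_add_of_le hsn
  set n := s + 1 + t with hnd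
  set P := n ^ 3 with hP
  obtain ⟨b, hb⟩ : ∃ b, 2 * n = b + 1 := ⟨2 * n - 1, by omega⟩
  have hb' : 2 * n - 1 = b := by omega
  have hP6 : n ^ 6 = P ^ 2 := by rw [hP]; ring
  rw [hb', hP6]
  have hφ : s * δ ≤ P := le_trans (Nat.mul_le_mul_right _ (by omega)) hδ
  have hsφ : s * (1 + s * δ) < n * P := by
    have h1 : (s + 1) * (s * δ) ≤ s * P := by
      calc (s + 1) * (s * δ) = s * ((s + 1) * δ) := by ring
        _ ≤ s * P := Nat.mul_le_mul_left _ hδ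
    have h2 : n < P := by
      rw [hP]; exact lt_self_pow₀ (by omega) (by norm_num)
    nlinarith
  have hnP : 0 < n * P := by positivity
  have hmain : s * (2 * n * P * (4 * n ^ 2 * P ^ 2 + b * P + s * δ) + s * δ * (2 * n * P) ^ 2) <
      4 * n ^ 2 * P ^ 2 * (b * P * (s + 1)) := by
    have e1 : s * (2 * n * P * (4 * n ^ 2 * P ^ 2 + b * P + s * δ) + s * δ * (2 * n * P) ^ 2) ≤
        s * (2 * n * P) * (4 * n ^ 2 * P ^ 2) + 4 * n ^ 2 * P ^ 2 * (s * (1 + s * δ)) := by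
      have : 2 * n * P * (b * P + s * δ) ≤ 4 * n ^ 2 * P ^ 2 := by
        have : b * P + s * δ ≤ 2 * n * P := by rw [hb]; linarith
        calc _ ≤ 2 * n * P * (2 * n * P) := Nat.mul_le_mul_left _ this
          _ = _ := by ring
      nlinarith
    have e2 : s * (2 * n * P) + n * P ≤ b * P * (s + 1) := by
      have : s * (2 * n) + n ≤ b * (s + 1) := by
        rw [hb]
        nlinarith
      calc _ = (s * (2 * n) + n) * P := by ring
        _ ≤ b * (s + 1) * P := Nat.mul_le_mul_right _ this
        _ = _ := by ring
    have e3 : 0 < 4 * n ^ 2 * P ^ 2 := by positivity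
    calc _ ≤ _ := e1
      _ = 4 * n ^ 2 * P ^ 2 * (s * (2 * n * P) + s * (1 + s * δ)) := by ring
      _ < 4 * n ^ 2 * P ^ 2 * (s * (2 * n * P) + n * P) := by gcongr
      _ ≤ _ := Nat.mul_le_mul_left _ e2
  calc _ = (s + 1) * (s * (2 * n * P * (4 * n ^ 2 * P ^ 2 + b * P + s * δ) +
        s * δ * (2 * n * P) ^ 2)) := by ring
    _ < (s + 1) * (4 * n ^ 2 * P ^ 2 * (b * P * (s + 1))) := by gcongr
    _ = _ := by ring

set_option maxHeartbeats 1000000 in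
/-- A curve of the given weighted degree has a rational point outside `h = 0`. -/
theorem exists_rational_point [IsAlgClosed K] (p e : ℕ) [Fact p.Prime] [CharP K p] {δ n : ℕ}
    (hm : G.Monic) (hirr : Irreducible G) (hr : 2 ≤ G.natDegree) (hrn : G.natDegree ≤ n)
    (hG : WtLE δ G (G.natDegree * δ)) (hδ : G.natDegree * δ ≤ n ^ 3)
    (hfix : ∀ j a, ((G.coeff j).coeff a) ^ p ^ e = (G.coeff j).coeff a)
    (hder : derivative G ≠ 0) {h : K[X]} (h0 : h ≠ 0) (hh : h.natDegree ≤ 2 * n) (hn : 5 ≤ n)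
    (hq : 8 * n ^ 9 ≤ p ^ e) :
    ∃ v y : K, v ^ p ^ e = v ∧ y ^ p ^ e = y ∧ h.eval v ≠ 0 ∧ bev (RingHom.id K) v y G = 0 := by
  classical
  by_contra! hno
  obtain ⟨s, hs⟩ : ∃ s, G.natDegree = s + 1 := ⟨G.natDegree - 1, by omega⟩
  have hs' : G.natDegree - 1 = s := by omega
  set q := p ^ e with hqd
  have hn9 : n ^ 9 = n ^ 3 * n ^ 6 := by ring
  have hn1 : 1 ≤ n ^ 3 := Nat.one_le_pow _ _ (by omega)
  have hn6 : 1 ≤ n ^ 6 := Nat.one_le_pow _ _ (by omega)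
  have hn8 : 1 ≤ n ^ 8 := Nat.one_le_pow _ _ (by omega)
  have h98 : n ^ 9 = n * n ^ 8 := by ring
  have hφ : s * δ ≤ n ^ 3 := le_trans (Nat.mul_le_mul_right _ (by omega)) hδ
  set M := 2 * n * n ^ 3 with hMd
  set α := 4 * n ^ 2 * n ^ 6 with hαd
  set β := (2 * n - 1) * n ^ 3 with hβd
  have hα1 : 1 ≤ α := by
    rw [hαd]; exact Nat.succ_le_of_lt (by positivity)
  have hβ1 : 1 ≤ β := by
    have : 0 < 2 * n - 1 := by omega
    rw [hβd]; exact Nat.succ_le_of_lt (by positivity)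
  have hβM : β + s * δ ≤ M := by
    obtain ⟨b, hb⟩ : ∃ b, 2 * n = b + 1 := ⟨2 * n - 1, by omega⟩
    have hb' : 2 * n - 1 = b := by omega
    rw [hβd, hMd, hb', hb, add_mul]
    linarith
  obtain ⟨ψ, d, hψ, hd, hvan⟩ := exists_coefficients (α := α) (β := β) (M := M) p e hm hG hs hα1 hβ1
    (by rw [hs] at hrn hδ ⊢; exact count_inequality (by omega) hrn hδ hn)
  have hα8 : α = 4 * n ^ 8 := by rw [hαd]; ring
  have hΦ : auxElt (p ^ e) d ≠ 0 := auxElt_ne_zero p e (ω := α + s * δ - 1) hm hirr hr hG hder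
    (by rw [hs']; omega) (by
      refine lt_of_lt_of_le ?_ hq
      calc G.natDegree * (α + s * δ - 1) ≤ n * (4 * n ^ 8 + n ^ 3) :=
            Nat.mul_le_mul hrn (by omega)
        _ < 8 * n ^ 9 := by
            have : n ^ 3 ≤ n ^ 8 := Nat.pow_le_pow_right (by omega) (by norm_num)
            nlinarith) ψ hψ hd
  have hMq : M ≤ q := by
    refine le_trans ?_ hq
    have : n ^ 3 ≤ n ^ 8 := Nat.pow_le_pow_right (by omega) (by norm_num)
    rw [hMd]; nlinarith
  have hNf := norm_ne_zero_of_irreducible hm hirr (mk_derivative_ne_zero hm hder)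
  set D := Algebra.norm K[X] (AdjoinRoot.mk G (derivative G)) * h with hD
  have hD0 : D ≠ 0 := mul_ne_zero hNf h0
  have hDdeg : D.natDegree ≤ G.natDegree * (s * δ) + 2 * n := by
    refine natDegree_mul_le.trans (add_le_add (natDegree_norm_le hm hG ?_) hh)
    rw [← bev_root]
    have := hG.derivative (by omega)
    rw [hs'] at this
    exact bev_mem_wtSpan this
  set good := (X ^ p ^ e - X : K[X]).roots.toFinset.filter fun v => D.eval v ≠ 0 with hgood
  have hmem : ∀ v ∈ good, v ^ q = v ∧ D.eval v ≠ 0 := by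
    intro v hv
    rw [hgood, Finset.mem_filter, Multiset.mem_toFinset, mem_roots'] at hv
    refine ⟨?_, hv.2⟩
    have := hv.1.2
    simpa [sub_eq_zero] using this
  have he : e ≠ 0 := by
    rintro rfl
    simp [hqd] at hq
    nlinarith
  have hcard : q ≤ good.card + (G.natDegree * (s * δ) + 2 * n) := by
    have h1 : good.card + ((X ^ p ^ e - X : K[X]).roots.toFinset.filter
        fun v => ¬ D.eval v ≠ 0).card = (X ^ p ^ e - X : K[X]).roots.toFinset.card := by
      rw [hgood]
      exact Finset.card_filter_add_card_filter_not _
    rw [card_roots_X_pow_sub_X p e he] at h1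
    have h2 : ((X ^ p ^ e - X : K[X]).roots.toFinset.filter fun v => ¬ D.eval v ≠ 0).card ≤
        D.natDegree := by
      refine le_trans (Finset.card_le_card (t := D.roots.toFinset) fun v hv => ?_)
        ((Multiset.toFinset_card_le _).trans (card_roots' D))
      rw [Multiset.mem_toFinset, mem_roots hD0]
      simpa using (Finset.mem_filter.1 hv).2
    omega
  have hdvd : ∀ v ∈ good, (X - C v) ^ (G.natDegree * M) ∣ Algebra.norm K[X] (auxElt q d) := by
    intro v hv
    obtain ⟨hvq, hvD⟩ := hmem v hv
    rw [hD, eval_mul] at hvD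
    obtain ⟨⟨y, hyi, hy⟩, hsep⟩ := exists_fibre hm (by omega) (left_ne_zero_of_mul hvD)
    let P : Fin G.natDegree → PairPts G := fun l =>
      ⟨v, y l, y l ^ q, hy l, by
        have := bev_pow p e hfix v (y l)
        rwa [← hqd, hvq, hy l, zero_pow (by omega)] at this,
        fun heq => hno v (y l) hvq heq.symm (right_ne_zero_of_mul hvD) (hy l)⟩
    have hP : ∀ l, (P l).f ≠ 0 := fun l => hsep _ (hy l)
    have := X_sub_C_pow_dvd_norm hm hyi (fun l => ψ (P l) (hP l)) (fun l => (hψ _ _).1)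
      (fun l => (hψ _ _).2) (g := auxElt q d) (N := fun _ => M)
      (fun l => hvan (P l) (hP l) hvq rfl hMq)
    simpa using this
  have hprod : (∏ v ∈ good, (X - C v) ^ (G.natDegree * M)) ∣ Algebra.norm K[X] (auxElt q d) :=
    Finset.prod_dvd_of_coprime (fun a _ b _ hab =>
      (isCoprime_X_sub_C_of_isUnit_sub (sub_ne_zero.2 hab).isUnit).pow) hdvd
  have hdeg := natDegree_le_of_dvd hprod (norm_ne_zero_of_irreducible hm hirr hΦ)
  rw [natDegree_prod _ _ fun v _ => pow_ne_zero _ (X_sub_C_ne_zero v)] at hdeg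
  simp only [natDegree_pow, natDegree_X_sub_C, mul_one, Finset.sum_const, smul_eq_mul] at hdeg
  have hup := natDegree_norm_le hm hG (auxElt_mem (q := q) (ω₁ := α + s * δ - 1)
    (ω₂ := β + s * δ - 1) d (by rw [hs']; omega) (by rw [hs']; omega))
  have h3 : good.card * M ≤ α + s * δ - 1 + q * (β + s * δ - 1) := by
    have := hdeg.trans hup
    refine Nat.le_of_mul_le_mul_left (c := G.natDegree) ?_ (by omega)
    linarith
  have hbad : G.natDegree * (s * δ) + 2 * n ≤ n ^ 4 + 2 * n := by
    have := Nat.mul_le_mul hrn hφ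
    have e4 : n * n ^ 3 = n ^ 4 := by ring
    omega
  have h4 : q ≤ α + s * δ + M * (n ^ 4 + 2 * n) := by
    have h5 : q * M ≤ (good.card + (n ^ 4 + 2 * n)) * M := Nat.mul_le_mul_right _ (by omega)
    have h6 : q * (β + s * δ - 1) + q ≤ q * M := by
      rw [← Nat.mul_succ]
      exact Nat.mul_le_mul_left _ (by omega)
    have h7 : α + s * δ - 1 ≤ α + s * δ := Nat.sub_le _ _
    rw [add_mul, mul_comm (n ^ 4 + 2 * n) M] at h5
    linarith only [h3, h5, h6, h7]
  have h8 : α + s * δ + M * (n ^ 4 + 2 * n) < 8 * n ^ 9 := by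
    rw [hα8, hMd]
    have e1 : n ^ 3 ≤ n ^ 8 := Nat.pow_le_pow_right (by omega) (by norm_num)
    have e2 : 2 * n * n ^ 3 * (n ^ 4 + 2 * n) = 2 * n ^ 8 + 4 * n ^ 5 := by ring
    have e3 : n ^ 5 ≤ n ^ 8 := Nat.pow_le_pow_right (by omega) (by norm_num)
    rw [e2, h98]
    nlinarith
  omega

end RationalPoints

section Inseparable

variable {K : Type*} [Field K]

theorem bev_expand {S : Type*} [CommRing S] (φ : K →+* S) (v y : S) (p : ℕ) (P : K[X][X]) :
    bev φ v y (expand K[X] p P) = bev φ v (y ^ p) P := by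
  rw [bev, bev, coe_eval₂RingHom, coe_eval₂RingHom, expand_eq_comp_X_pow, eval₂_comp]
  simp

/-- The separability hypothesis in `exists_rational_point` is superfluous. -/
theorem exists_rational_point' [IsAlgClosed K] (p e : ℕ) [Fact p.Prime] [CharP K p] {n : ℕ}
    {h : K[X]} (h0 : h ≠ 0) (hh : h.natDegree ≤ 2 * n) (hn : 5 ≤ n) (hq : 8 * n ^ 9 ≤ p ^ e)
    (r : ℕ) : ∀ (δ : ℕ) (G : K[X][X]), G.natDegree = r → G.Monic → Irreducible G →
    1 ≤ r → r ≤ n → WtLE δ G (r * δ) → r * δ ≤ n ^ 3 →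
    (∀ j a, ((G.coeff j).coeff a) ^ p ^ e = (G.coeff j).coeff a) →
    ∃ v y : K, v ^ p ^ e = v ∧ y ^ p ^ e = y ∧ h.eval v ≠ 0 ∧ bev (RingHom.id K) v y G = 0 := by
  classical
  have hp : p.Prime := Fact.out
  have he : e ≠ 0 := by
    rintro rfl
    have := Nat.one_le_pow 9 n (by omega)
    simp at hq
    omega
  induction r using Nat.strong_induction_on with
  | _ r ih =>
    intro δ G hdeg hm hirr hr hrn hG hδ hfix
    by_cases hr1 : r = 1
    · obtain ⟨v, hv, hv0⟩ : ∃ v : K, v ^ p ^ e = v ∧ h.eval v ≠ 0 := by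
        by_contra! hno
        have h1 : (X ^ p ^ e - X : K[X]).roots.toFinset ⊆ h.roots.toFinset := by
          intro v hv
          rw [Multiset.mem_toFinset, mem_roots'] at hv
          rw [Multiset.mem_toFinset, mem_roots h0]
          have := hv.2
          exact hno v (by simpa [sub_eq_zero] using this)
        have h2 := Finset.card_le_card h1
        rw [card_roots_X_pow_sub_X p e he] at h2
        have h3 := (h2.trans (Multiset.toFinset_card_le _)).trans (card_roots' h)
        have h4 : n ≤ n ^ 9 := Nat.le_self_pow (by norm_num) n
        omega
      have hroot : bev (RingHom.id K) v (-(G.coeff 0).eval v) G = 0 := by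
        have : G = X + C (G.coeff 0) := by
          have h5 := hm.coeff_natDegree
          rw [hdeg, hr1] at h5
          nth_rewrite 1 [eq_X_add_C_of_natDegree_le_one (hdeg.trans hr1).le]
          rw [h5, C_1, one_mul]
        rw [this, map_add, bev_X, bev_C, ← this]
        simp [eval₂_id]
      refine ⟨v, _, hv, ?_, hv0, hroot⟩
      have h6 := bev_pow p e hfix v (-(G.coeff 0).eval v)
      rw [hv, hroot, zero_pow (by positivity [hp.pos])] at h6
      have h7 : ∀ y, bev (RingHom.id K) v y G = y + (G.coeff 0).eval v := by
        intro y
        have : G = X + C (G.coeff 0) := by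
          have h5 := hm.coeff_natDegree
          rw [hdeg, hr1] at h5
          nth_rewrite 1 [eq_X_add_C_of_natDegree_le_one (hdeg.trans hr1).le]
          rw [h5, C_1, one_mul]
        rw [this, map_add, bev_X, bev_C, ← this]
        simp [eval₂_id]
      rw [h7] at h6
      linear_combination h6
    by_cases hder : derivative G = 0
    · have hexp := expand_contract p hder hp.ne_zero
      set G₁ := contract p G with hG₁
      have hd₁ : G₁.natDegree * p = r := by rw [← natDegree_expand, hexp, hdeg]
      have hpos : 0 < G₁.natDegree := by
        rcases Nat.eq_zero_or_pos G₁.natDegree with h | h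
        · rw [h] at hd₁; omega
        · exact h
      have hcoeff : ∀ j, G₁.coeff j = G.coeff (j * p) := fun j => by
        rw [hG₁, coeff_contract hp.ne_zero]
      obtain ⟨v, y, hv, hy, hv0, hroot⟩ := ih G₁.natDegree
        (by rw [← hd₁]; exact lt_mul_of_one_lt_right hpos hp.one_lt) (δ * p) G₁ rfl
        ((monic_expand_iff hp.pos).1 (hexp ▸ hm)) (of_irreducible_expand hp.ne_zero (hexp ▸ hirr))
        hpos (le_trans (by rw [← hd₁]; exact Nat.le_mul_of_pos_right _ hp.pos) hrn)
        (by
          intro j a hja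
          rw [hcoeff] at hja
          have := hG _ _ hja
          rw [← hd₁] at this
          linarith)
        (by rw [← hd₁] at hδ; linarith)
        (by intro j a; rw [hcoeff]; exact hfix _ _)
      refine ⟨v, y ^ p ^ (e - 1), hv, ?_, hv0, ?_⟩
      · rw [← pow_mul, mul_comm, pow_mul, hy]
      · rw [← hexp, bev_expand, ← pow_mul, ← pow_succ, Nat.sub_add_cancel (by omega), hy, hroot]
    · subst hdeg
      exact exists_rational_point p e hm hirr (by omega) hrn hG hδ hfix hder h0 hh hn hq

end Inseparable

section Weight

variable {K : Type*} [Field K]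

/-- The substitution `c ↦ c`, `X ↦ T`, `Y ↦ Y * T ^ δ` turning the weight into a degree. -/
noncomputable def wtHom (K : Type*) [Field K] (δ : ℕ) : K[X][X] →+* K[X][X] :=
  bev (C.comp C) X (C X * X ^ δ)

theorem coeff_coeff_wtHom (δ : ℕ) (G : K[X][X]) (m j : ℕ) :
    ((wtHom K δ G).coeff m).coeff j = if δ * j ≤ m then (G.coeff j).coeff (m - δ * j) else 0 := by
  induction G using Polynomial.induction_on' with
  | add P Q hP hQ =>
    rw [map_add, coeff_add, coeff_add, hP, hQ, coeff_add, coeff_add]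
    split_ifs <;> simp
  | monomial i a =>
    induction a using Polynomial.induction_on' with
    | add P Q hP hQ =>
      rw [map_add, map_add, coeff_add, coeff_add, hP, hQ, coeff_add, coeff_add]
      split_ifs <;> simp
    | monomial k c =>
      have : wtHom K δ (monomial i (monomial k c)) =
          C (C c * X ^ i) * X ^ (k + δ * i) := by
        rw [← C_mul_X_pow_eq_monomial, ← C_mul_X_pow_eq_monomial, wtHom]
        simp only [map_mul, map_pow, bev_C, bev_X, eval₂_C, eval₂_X]
        simp only [RingHom.comp_apply]
        ring
      rw [this, coeff_C_mul_X_pow, coeff_monomial]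
      by_cases hij : i = j
      · subst hij
        rw [if_pos rfl, coeff_monomial]
        split_ifs with h1 h2 h3 h4 h5
        · simp
        · omega
        · omega
        · omega
        · simp
        · simp
      · rw [if_neg hij]
        split_ifs <;> simp [coeff_X_pow, Ne.symm hij]

theorem wtLE_iff {δ ω : ℕ} {G : K[X][X]} : WtLE δ G ω ↔ (wtHom K δ G).natDegree ≤ ω := by
  constructor
  · intro h
    rw [natDegree_le_iff_coeff_eq_zero]
    intro m hm
    ext j
    rw [coeff_coeff_wtHom, coeff_zero]
    split_ifs with hj
    · by_contra hne
      have := h j _ hne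
      omega
    · rfl
  · intro h j a hja
    by_contra! hlt
    have h1 : (wtHom K δ G).coeff (a + δ * j) = 0 := coeff_eq_zero_of_natDegree_lt (by omega)
    have h2 := coeff_coeff_wtHom δ G (a + δ * j) j
    rw [h1, if_pos (by omega), Nat.add_sub_cancel, coeff_zero] at h2
    exact hja h2.symm

theorem Polynomial.Monic.le_natDegree_wtHom {δ : ℕ} {G : K[X][X]} (hm : G.Monic) :
    G.natDegree * δ ≤ (wtHom K δ G).natDegree := by
  apply le_natDegree_of_ne_zero
  intro h0
  have h2 := coeff_coeff_wtHom δ G (G.natDegree * δ) G.natDegree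
  rw [h0, if_pos (by rw [mul_comm]), mul_comm, Nat.sub_self, hm.coeff_natDegree] at h2
  simp at h2

theorem WtLE.of_mul_left {δ : ℕ} {G H : K[X][X]} (hG : G.Monic) (hH : H.Monic)
    (h : WtLE δ (G * H) ((G * H).natDegree * δ)) : WtLE δ G (G.natDegree * δ) := by
  rw [wtLE_iff] at h ⊢
  have h1 := hG.le_natDegree_wtHom (δ := δ)
  have h2 := hH.le_natDegree_wtHom (δ := δ)
  have hne : ∀ {P : K[X][X]}, P.Monic → wtHom K δ P ≠ 0 := by
    intro P hP h0
    have h3 := coeff_coeff_wtHom δ P (P.natDegree * δ) P.natDegree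
    rw [h0, if_pos (by rw [mul_comm]), mul_comm, Nat.sub_self, hP.coeff_natDegree] at h3
    simp at h3
  rw [map_mul, natDegree_mul (hne hG) (hne hH), hG.natDegree_mul hH] at h
  nlinarith

end Weight

section Factor

variable {A : Type*} [CommRing A] [IsDomain A]

/-- A prime dividing the constant coefficient exactly once singles out an irreducible factor. -/
theorem exists_irreducible_factor {π : A} (hπ : Prime π) (r : ℕ) : ∀ F : A[X], F.natDegree = r →
    F.Monic → π ∣ F.coeff 0 → ¬ π ^ 2 ∣ F.coeff 0 →
    ∃ F₁ F₂ : A[X], F₁.Monic ∧ Irreducible F₁ ∧ F₂.Monic ∧ F₁ * F₂ = F ∧ ¬ π ∣ F₂.coeff 0 := by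
  induction r using Nat.strong_induction_on with
  | _ r ih =>
    intro F hr hm hd hd2
    have hF1 : F ≠ 1 := by
      rintro rfl
      rw [coeff_one_zero] at hd
      exact hπ.not_isUnit (isUnit_of_dvd_one hd)
    by_cases hirr : Irreducible F
    · refine ⟨F, 1, hm, hirr, monic_one, mul_one _, ?_⟩
      rw [coeff_one_zero]
      exact fun h => hπ.not_isUnit (isUnit_of_dvd_one h)
    rw [hm.irreducible_iff_natDegree] at hirr
    push Not at hirr
    obtain ⟨f, g, hf, hg, hfg, hf0, hg0⟩ := hirr hF1
    have hdeg := hf.natDegree_mul hg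
    rw [hfg, hr] at hdeg
    have main : ∀ f g : A[X], f.Monic → g.Monic → f * g = F → f.natDegree < r → π ∣ f.coeff 0 →
        ∃ F₁ F₂ : A[X], F₁.Monic ∧ Irreducible F₁ ∧ F₂.Monic ∧ F₁ * F₂ = F ∧
          ¬ π ∣ F₂.coeff 0 := by
      intro f g hf hg hfg hlt hπf
      have hc : F.coeff 0 = f.coeff 0 * g.coeff 0 := by rw [← hfg, mul_coeff_zero]
      obtain ⟨F₁, F₂, h1, h2, h3, h4, h5⟩ := ih _ hlt f rfl hf hπf
        (fun h => hd2 (hc ▸ h.mul_right _))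
      refine ⟨F₁, F₂ * g, h1, h2, h3.mul hg, by rw [← mul_assoc, h4, hfg], fun h => ?_⟩
      rw [mul_coeff_zero] at h
      rcases hπ.dvd_or_dvd h with h | h
      · exact h5 h
      · exact hd2 (by rw [hc, sq]; exact mul_dvd_mul hπf h)
    have hc : F.coeff 0 = f.coeff 0 * g.coeff 0 := by rw [← hfg, mul_coeff_zero]
    rw [hc] at hd
    rcases hπ.dvd_or_dvd hd with h | h
    · exact main f g hf hg hfg (by omega) h
    · exact main g f hg hf (by rw [mul_comm, hfg]) (by omega) h

end Factor

section Curve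

variable {K : Type*} [Field K]

theorem le_natDegree_of_X_pow_dvd {F₁ F₂ : K[X][X]} {θ : K} {k : ℕ} (h1 : F₁.Monic)
    (h2 : ¬ (X - C θ) ∣ F₂.coeff 0) (hk : ∀ i < k, ((F₁ * F₂).coeff i).eval θ = 0) :
    k ≤ F₁.natDegree := by
  have hX : (X : K[X]) ^ k ∣ F₁.map (evalRingHom θ) * F₂.map (evalRingHom θ) := by
    rw [← Polynomial.map_mul, X_pow_dvd_iff]
    intro i hi
    rw [coeff_map]
    exact hk i hi
  have hnd : ¬ X ∣ F₂.map (evalRingHom θ) := by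
    rw [X_dvd_iff, coeff_map]
    rwa [dvd_iff_isRoot] at h2
  have hm := h1.map (evalRingHom θ)
  have := natDegree_le_of_dvd (prime_X.pow_dvd_of_dvd_mul_right _ hnd hX) hm.ne_zero
  rwa [natDegree_X_pow, h1.natDegree_map] at this

/-- A large monic irreducible factor is stable under Frobenius. -/
theorem coeff_fixed_of_factor [IsAlgClosed K] (p e : ℕ) [Fact p.Prime] [CharP K p]
    {F₁ F₂ : K[X][X]} (h1 : F₁.Monic) (hirr : Irreducible F₁) (h2 : F₂.Monic)
    (hlt : F₂.natDegree < F₁.natDegree)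
    (hfix : ∀ j a, (((F₁ * F₂).coeff j).coeff a) ^ p ^ e = ((F₁ * F₂).coeff j).coeff a) :
    ∀ j a, ((F₁.coeff j).coeff a) ^ p ^ e = (F₁.coeff j).coeff a := by
  let E : K[X][X] ≃+* K[X][X] := mapEquiv (mapEquiv (iterateFrobeniusEquiv K p e))
  have hE : ∀ P j a, ((E P).coeff j).coeff a = ((P.coeff j).coeff a) ^ p ^ e := by
    intro P j a
    simp [E, coeff_map, iterateFrobenius_def]
  have hEF : E (F₁ * F₂) = F₁ * F₂ := by
    ext j a
    rw [hE, hfix]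
  have hdeg : (E F₁).natDegree = F₁.natDegree := by
    simp only [E, mapEquiv_apply]
    exact h1.natDegree_map _
  have hEm : (E F₁).Monic := by
    simp only [E, mapEquiv_apply]
    exact h1.map _
  have hprime : Prime (E F₁) := ((MulEquiv.irreducible_iff E).2 hirr).prime
  have hdvd : E F₁ ∣ F₁ * F₂ := by
    rw [← hEF, map_mul]
    exact dvd_mul_right _ _
  rcases hprime.dvd_or_dvd hdvd with h | h
  · have heq : F₁ = E F₁ := eq_of_monic_of_dvd_of_natDegree_le hEm h1 h hdeg.ge
    intro j a
    rw [← hE, ← heq]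
  · have := natDegree_le_of_dvd h h2.ne_zero
    omega

theorem exists_rational_point_of_monic [IsAlgClosed K] (p e : ℕ) [Fact p.Prime] [CharP K p]
    {n k : ℕ} {h : K[X]} (h0 : h ≠ 0) (hh : h.natDegree ≤ 2 * n) (hn : 5 ≤ n)
    (hq : 8 * n ^ 9 ≤ p ^ e) {F : K[X][X]} (hm : F.Monic) (hdeg : F.natDegree = n)
    (hw : WtLE (n ^ 2) F (n * n ^ 2))
    (hfix : ∀ j a, ((F.coeff j).coeff a) ^ p ^ e = (F.coeff j).coeff a) {θ : K}
    (hk : n < 2 * k) (hcoeff : ∀ i < k, (F.coeff i).eval θ = 0)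
    (h2 : ¬ (X - C θ) ^ 2 ∣ F.coeff 0) :
    ∃ v y : K, v ^ p ^ e = v ∧ y ^ p ^ e = y ∧ h.eval v ≠ 0 ∧ bev (RingHom.id K) v y F = 0 := by
  obtain ⟨F₁, F₂, hm1, hirr, hm2, hF, hnd⟩ := exists_irreducible_factor (prime_X_sub_C θ) _ F rfl hm
    (dvd_iff_isRoot.2 (hcoeff 0 (by omega))) h2
  subst hF
  have hk1 := le_natDegree_of_X_pow_dvd hm1 hnd hcoeff
  have hsum := hm1.natDegree_mul hm2
  rw [hdeg] at hsum
  have hw1 : WtLE (n ^ 2) F₁ (F₁.natDegree * n ^ 2) := WtLE.of_mul_left hm1 hm2 (hdeg.symm ▸ hw)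
  obtain ⟨v, y, hv, hy, hv0, hroot⟩ := exists_rational_point' p e h0 hh hn hq F₁.natDegree (n ^ 2)
    F₁
    rfl hm1 hirr (by omega) (by omega) hw1
    (by calc F₁.natDegree * n ^ 2 ≤ n * n ^ 2 := Nat.mul_le_mul_right _ (by omega)
          _ = n ^ 3 := by ring)
    (coeff_fixed_of_factor p e hm1 hirr hm2 (by omega) hfix)
  exact ⟨v, y, hv, hy, hv0, by rw [map_mul, hroot, zero_mul]⟩

end Curve

section NonMonic

variable {K : Type*} [Field K]

theorem coeff_pow_eq_iff_map (p e : ℕ) [Fact p.Prime] [CharP K p] (P : K[X]) :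
    (∀ a, P.coeff a ^ p ^ e = P.coeff a) ↔ P.map (iterateFrobenius K p e) = P := by
  rw [Polynomial.ext_iff]
  simp [iterateFrobenius_def]

/-- A version of `exists_rational_point_of_monic` for polynomials which are not monic: the point
may also lie at infinity. -/
theorem exists_rational_point_or_infinity [IsAlgClosed K] (p e : ℕ) [Fact p.Prime] [CharP K p]
    {n k : ℕ} {h : K[X]} (h0 : h ≠ 0) (hh : h.natDegree ≤ 2 * n) (hn : 5 ≤ n)
    (hq : 8 * n ^ 9 ≤ p ^ e) {P : K[X][X]} (hdeg : P.natDegree ≤ n)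
    (hw : ∀ i, (P.coeff i).natDegree ≤ n ^ 2)
    (hfix : ∀ j a, ((P.coeff j).coeff a) ^ p ^ e = (P.coeff j).coeff a) {θ : K}
    (hκ : (P.coeff n).eval θ ≠ 0)
    (hk : n < 2 * k) (hcoeff : ∀ i < k, (P.coeff i).eval θ = 0)
    (h2 : ¬ (X - C θ) ^ 2 ∣ P.coeff 0) :
    ∃ v : K, v ^ p ^ e = v ∧ h.eval v ≠ 0 ∧ ((P.coeff n).eval v = 0 ∨
      ∃ u, u ^ p ^ e = u ∧ bev (RingHom.id K) v u P = 0) := by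
  have hn0 : P.coeff n ≠ 0 := by
    intro h
    simp [h] at hκ
  have hP : P.natDegree = n := le_antisymm hdeg (le_natDegree_of_ne_zero hn0)
  have hP0 : P ≠ 0 := by
    rintro rfl
    simp at hn0
  have hlc : P.leadingCoeff = P.coeff n := by rw [leadingCoeff, hP]
  have hc : ∀ i, i ≠ n → P.integralNormalization.coeff i =
      P.coeff i * P.coeff n ^ (n - 1 - i) := by
    intro i hi
    rw [integralNormalization_coeff_ne_natDegree (by rwa [hP]), hlc, hP]
  have hcn : P.integralNormalization.coeff n = 1 := by
    rw [← hP, integralNormalization_coeff_natDegree hP0]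
  obtain ⟨v, y, hv, hy, hv0, hroot⟩ := exists_rational_point_of_monic p e (n := n) (k := k)
    (θ := θ) h0 hh hn hq
    (monic_integralNormalization hP0) (natDegree_integralNormalization.trans hP) (by
      intro j a hja
      by_cases hj : j = n
      · rw [hj, hcn, coeff_one] at hja
        have : a = 0 := by by_contra h; simp [h] at hja
        rw [hj, this, zero_add, mul_comm]
      · rw [hc j hj] at hja
        have hjn : j < n := by
          by_contra! hlt
          rw [coeff_eq_zero_of_natDegree_lt (p := P) (n := j) (by omega), zero_mul,
            coeff_zero] at hja
          exact hja rfl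
        have h3 := le_natDegree_of_ne_zero hja
        have h4 := (h3.trans natDegree_mul_le).trans (add_le_add (hw j)
          (natDegree_pow_le.trans (Nat.mul_le_mul_left _ (hw n))))
        obtain ⟨t, rfl⟩ : ∃ t, n = j + 1 + t := Nat.exists_eq_add_of_le hjn
        have h5 : j + 1 + t - 1 - j = t := by omega
        rw [h5] at h4
        calc a + (j + 1 + t) ^ 2 * j ≤ (j + 1 + t) ^ 2 + t * (j + 1 + t) ^ 2 +
              (j + 1 + t) ^ 2 * j := Nat.add_le_add_right h4 _
          _ = _ := by ring) (by
      intro j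
      rw [coeff_pow_eq_iff_map]
      by_cases hj : j = n
      · rw [hj, hcn, Polynomial.map_one]
      · rw [hc j hj, Polynomial.map_mul, Polynomial.map_pow, (coeff_pow_eq_iff_map p e _).1 (hfix
        j),
          (coeff_pow_eq_iff_map p e _).1 (hfix n)]) hk (by
      intro i hi
      by_cases hin : i = n
      · exact absurd (hcoeff n (hin ▸ hi)) hκ
      · rw [hc i hin, eval_mul, hcoeff i hi, zero_mul]) (by
      rw [hc 0 (by omega)]
      intro hd
      refine h2 ((prime_X_sub_C θ).pow_dvd_of_dvd_mul_right 2 ?_ hd)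
      intro h3
      have h4 := (prime_X_sub_C θ).dvd_of_dvd_pow h3
      exact hκ (dvd_iff_isRoot.1 h4))
  refine ⟨v, hv, hv0, or_iff_not_imp_left.2 fun hκv => ⟨y * ((P.coeff n).eval v)⁻¹, ?_, ?_⟩⟩
  · rw [mul_pow, inv_pow, hy]
    congr 2
    have h5 := congrArg (eval v) ((coeff_pow_eq_iff_map p e _).1 (hfix n))
    have h6 := Polynomial.eval_map_apply (iterateFrobenius K p e) (p := P.coeff n) v
    rw [iterateFrobenius_def, iterateFrobenius_def, hv] at h6
    rw [← h6, h5]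
  · have h7 := integralNormalization_eval₂_leadingCoeff_mul (p := P) (by omega)
      (eval₂RingHom (RingHom.id K) v) (y * ((P.coeff n).eval v)⁻¹)
    have h8 : eval₂RingHom (RingHom.id K) v P.leadingCoeff = (P.coeff n).eval v := by
      rw [hlc]; rfl
    rw [h8, mul_comm y, mul_inv_cancel_left₀ hκv] at h7
    have h9 : eval₂ (eval₂RingHom (RingHom.id K) v) y P.integralNormalization = 0 := hroot
    rw [h9] at h7
    rw [mul_comm y]
    exact (mul_eq_zero.1 h7.symm).resolve_left (pow_ne_zero _ hκv)

theorem mem_range_algebraMap_of_pow_eq {F Ω : Type*} [Field F] [Fintype F] [Field Ω]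
    [Algebra F Ω] {q n : ℕ} (hcard : Fintype.card F = q ^ n) {x : Ω} (hx : x ^ q = x) :
    ∃ a : F, algebraMap F Ω a = x := by
  have hx' : x ^ Fintype.card F = x := by
    rw [hcard]
    clear hcard
    induction n with
    | zero => simp
    | succ n ih => rw [pow_succ, pow_mul, ih, hx]
  have h1 : (X ^ Fintype.card F - X : F[X]) = ∏ a : F, (X - C a) := by
    have hm : (X ^ Fintype.card F - X : F[X]).Monic :=
      monic_X_pow_sub (by rw [degree_X]; exact_mod_cast Fintype.one_lt_card)
    have := prod_multiset_X_sub_C_of_monic_of_roots_card_eq hm (by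
      rw [FiniteField.roots_X_pow_card_sub_X,
        FiniteField.X_pow_card_sub_X_natDegree_eq _ Fintype.one_lt_card]
      rfl)
    rw [FiniteField.roots_X_pow_card_sub_X] at this
    exact this.symm
  have h2 := congrArg (aeval x) h1
  rw [map_sub, map_pow, aeval_X, hx', sub_self, map_prod] at h2
  obtain ⟨a, -, ha⟩ := Finset.prod_eq_zero_iff.1 h2.symm
  refine ⟨a, ?_⟩
  rw [map_sub, aeval_X, aeval_C, sub_eq_zero] at ha
  exact ha.symm

/-- The version of `exists_rational_point_or_infinity` over a finite field. -/
theorem exists_rational_point_finite {F : Type*} [Field F] [Fintype F] (p e : ℕ) [Fact p.Prime]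
    [CharP F p] {n k : ℕ} (hcard : Fintype.card F = (p ^ e) ^ n) {h : F[X]} (h0 : h ≠ 0)
    (hh : h.natDegree ≤ 2 * n) (hn : 5 ≤ n) (hq : 8 * n ^ 9 ≤ p ^ e) {P : F[X][X]}
    (hdeg : P.natDegree ≤ n) (hw : ∀ i, (P.coeff i).natDegree ≤ n ^ 2)
    (hfix : ∀ j a, ((P.coeff j).coeff a) ^ p ^ e = (P.coeff j).coeff a) {θ : F}
    (hκ : (P.coeff n).eval θ ≠ 0)
    (hk : n < 2 * k) (hcoeff : ∀ i < k, (P.coeff i).eval θ = 0)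
    (h2 : ¬ (X - C θ) ^ 2 ∣ P.coeff 0) :
    ∃ v : F, v ^ p ^ e = v ∧ h.eval v ≠ 0 ∧ ((P.coeff n).eval v = 0 ∨
      ∃ u, u ^ p ^ e = u ∧ bev (RingHom.id F) v u P = 0) := by
  let ι := algebraMap F (AlgebraicClosure F)
  have hι : Function.Injective ι := ι.injective
  have : CharP (AlgebraicClosure F) p := charP_of_injective_algebraMap hι p
  obtain ⟨v, hv, hv0, hvP⟩ := exists_rational_point_or_infinity p e (n := n) (k := k)
    (h := h.map ι) (P := P.map (mapRingHom ι)) (θ := ι θ) ((Polynomial.map_ne_zero_iff hι).2 h0)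
    (natDegree_map_le.trans hh) hn hq (natDegree_map_le.trans hdeg)
    (fun i => by rw [coeff_map]; exact natDegree_map_le.trans (hw i))
    (fun j a => by rw [coeff_map, coe_mapRingHom, coeff_map, ← map_pow, hfix])
    (by rw [coeff_map, coe_mapRingHom, eval_map_apply]; exact (map_ne_zero_iff ι hι).2 hκ) hk
    (fun i hi => by rw [coeff_map, coe_mapRingHom, eval_map_apply, hcoeff i hi, map_zero]) (by
      rw [coeff_map, coe_mapRingHom]
      have : (X - C (ι θ)) ^ 2 = ((X - C θ) ^ 2).map ι := by simp
      rw [this, map_dvd_map _ hι ((monic_X_sub_C θ).pow 2)]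
      exact h2)
  obtain ⟨v, rfl⟩ := mem_range_algebraMap_of_pow_eq hcard hv
  rw [eval_map_apply] at hv0
  refine ⟨v, hι (by rw [map_pow]; exact hv), (map_ne_zero_iff ι hι).1 hv0, ?_⟩
  rcases hvP with h | ⟨u, hu, huP⟩
  · left
    rw [coeff_map, coe_mapRingHom, eval_map_apply] at h
    exact (map_eq_zero_iff ι hι).1 h
  · right
    obtain ⟨u, rfl⟩ := mem_range_algebraMap_of_pow_eq hcard hu
    refine ⟨u, hι (by rw [map_pow]; exact hu), hι ?_⟩
    rw [map_zero, map_bev, ← huP, bev, bev, coe_eval₂RingHom, coe_eval₂RingHom, eval₂_map]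
    congr 1
    ext <;> simp [ι]

end NonMonic

section LinearProducts

variable {R ι : Type*} [CommRing R]

theorem natDegree_C_add_X_mul_C_le (a b : R) : (C a + X * C b).natDegree ≤ 1 := by
  rw [X_mul_C, add_comm]
  exact natDegree_linear_le

theorem natDegree_prod_linear_le (s : Finset ι) (a b : ι → R) :
    (∏ j ∈ s, (C (a j) + X * C (b j))).natDegree ≤ s.card := by
  refine (natDegree_prod_le _ _).trans ?_
  simpa using Finset.sum_le_card_nsmul s _ 1 fun j _ => natDegree_C_add_X_mul_C_le (a j) (b j)

theorem coeff_card_prod_linear (s : Finset ι) (a b : ι → R) :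
    (∏ j ∈ s, (C (a j) + X * C (b j))).coeff s.card = ∏ j ∈ s, b j := by
  have := coeff_prod_of_natDegree_le s (fun j => C (a j) + X * C (b j)) 1
    fun j _ => natDegree_C_add_X_mul_C_le (a j) (b j)
  rw [mul_one] at this
  rw [this]
  refine Finset.prod_congr rfl fun j _ => ?_
  simp

theorem coeff_zero_prod_linear (s : Finset ι) (a b : ι → R) :
    (∏ j ∈ s, (C (a j) + X * C (b j))).coeff 0 = ∏ j ∈ s, a j := by
  simp [coeff_zero_eq_eval_zero, eval_prod]

theorem natDegree_coeff_prod_linear_le (s : Finset ι) (a b : ι → R[X]) {d : ℕ}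
    (ha : ∀ j ∈ s, (a j).natDegree ≤ d) (hb : ∀ j ∈ s, (b j).natDegree ≤ d) (i : ℕ) :
    ((∏ j ∈ s, (C (a j) + X * C (b j))).coeff i).natDegree ≤ s.card * d := by
  classical
  induction s using Finset.induction_on generalizing i with
  | empty =>
    rw [Finset.prod_empty, coeff_one]
    split_ifs <;> simp
  | insert j s hj ih =>
    have hs : ∀ i, ((∏ j ∈ s, (C (a j) + X * C (b j))).coeff i).natDegree ≤ s.card * d :=
      ih (fun k hk => ha k (Finset.mem_insert_of_mem hk))
        (fun k hk => hb k (Finset.mem_insert_of_mem hk))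
    have hja := ha j (Finset.mem_insert_self j s)
    have hjb := hb j (Finset.mem_insert_self j s)
    rw [Finset.prod_insert hj, Finset.card_insert_of_notMem hj, add_mul, coeff_add, coeff_C_mul,
      X_mul_C, mul_assoc, coeff_C_mul, add_one_mul]
    refine (natDegree_add_le_of_degree_le (n := s.card * d + d) ?_ ?_)
    · refine natDegree_mul_le.trans ?_
      have := hs i
      omega
    · refine natDegree_mul_le.trans ?_
      rcases i with _ | i
      · simp; omega
      · rw [coeff_X_mul]
        have := hs i
        omega

theorem X_pow_dvd_prod_linear [DecidableEq R] (s : Finset ι) (a b : ι → R) :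
    X ^ (s.filter fun j => a j = 0).card ∣ ∏ j ∈ s, (C (a j) + X * C (b j)) := by
  rw [← Finset.prod_const]
  refine (Finset.prod_dvd_prod_of_dvd _ (fun j => C (a j) + X * C (b j)) fun j hj => ?_).trans
    (Finset.prod_dvd_prod_of_subset _ _ _ (Finset.filter_subset _ s))
  rw [(Finset.mem_filter.1 hj).2, C_0, zero_add]
  exact dvd_mul_right _ _

end LinearProducts

section Interpolation

variable {F : Type*} [Field F] {n : ℕ} [NeZero n]

theorem exists_interpolation (Θ : ZMod n → F →+* F)
    (hΘ : ∀ i j x, Θ (i + j) x = Θ i (Θ j x)) (h0 : ∀ x, Θ 0 x = x) {θ : F}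
    (hθ : Function.Injective fun j => Θ j θ) (σ : ZMod n → F) :
    ∃ A : F[X], A.natDegree ≤ n ∧ ∀ j, (A.map (Θ j)).eval θ = σ j := by
  classical
  have hinj : Set.InjOn (fun j => Θ (-j) θ) (Finset.univ : Finset (ZMod n)) := by
    intro i _ j _ h
    exact neg_injective (hθ h)
  refine ⟨Lagrange.interpolate Finset.univ (fun j => Θ (-j) θ) fun j => Θ (-j) (σ j), ?_, ?_⟩
  · have := Lagrange.degree_interpolate_lt (fun j => Θ (-j) (σ j)) hinj
    rw [Finset.card_univ, ZMod.card] at this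
    exact natDegree_le_of_degree_le this.le
  · intro j
    have h1 : θ = Θ j (Θ (-j) θ) := by rw [← hΘ, add_neg_cancel, h0]
    have h2 := eval_map_apply (Θ j) (p := Lagrange.interpolate Finset.univ (fun j => Θ (-j) θ)
      fun j => Θ (-j) (σ j)) (Θ (-j) θ)
    rw [← h1] at h2
    rw [h2, Lagrange.eval_interpolate_at_node _ hinj (Finset.mem_univ j), ← hΘ,
      add_neg_cancel, h0]

theorem map_prod_orbit (Θ : ZMod n → F →+* F) (hΘ : ∀ i j x, Θ (i + j) x = Θ i (Θ j x)) (θ : F)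
    (i : ZMod n) : (∏ j, (X - C (Θ j θ))).map (Θ i) = ∏ j, (X - C (Θ j θ)) := by
  rw [Polynomial.map_prod]
  simp only [Polynomial.map_sub, map_X, map_C, ← hΘ]
  exact Fintype.prod_equiv (Equiv.addLeft i) _ _ fun j => rfl

/-- Interpolation with a prescribed simple zero. -/
theorem exists_interpolation_simple (Θ : ZMod n → F →+* F)
    (hΘ : ∀ i j x, Θ (i + j) x = Θ i (Θ j x)) (h0 : ∀ x, Θ 0 x = x) {θ : F}
    (hθ : Function.Injective fun j => Θ j θ) (σ : ZMod n → F) {k : ZMod n} (hk : k ≠ 0) :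
    ∃ A : F[X], A.natDegree ≤ n ∧ (∀ j, (A.map (Θ j)).eval θ = σ j) ∧
      ¬ (X - C θ) ^ 2 ∣ A.map (Θ k) - A.map (Θ 0) := by
  classical
  obtain ⟨A, hA, hval⟩ := exists_interpolation Θ hΘ h0 hθ σ
  by_cases hs : (X - C θ) ^ 2 ∣ A.map (Θ k) - A.map (Θ 0)
  swap
  · exact ⟨A, hA, hval, hs⟩
  set G := ∏ j, (X - C (Θ j θ)) with hG
  have hfac : G = (X - C θ) * ∏ j ∈ Finset.univ.erase 0, (X - C (Θ j θ)) := by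
    rw [hG, ← Finset.mul_prod_erase _ _ (Finset.mem_univ 0), h0]
  have hGθ : G.eval θ = 0 := by simp [hfac]
  have hGn : ¬ (X - C θ) ^ 2 ∣ G := by
    rw [hfac, sq, mul_dvd_mul_iff_left (X_sub_C_ne_zero θ), dvd_iff_isRoot, IsRoot, eval_prod,
      Finset.prod_eq_zero_iff]
    rintro ⟨j, hj, h⟩
    rw [eval_sub, eval_X, eval_C, sub_eq_zero] at h
    refine Finset.ne_of_mem_erase hj (hθ ?_)
    simp only [h0]
    exact h.symm
  refine ⟨A + C θ * G, ?_, ?_, ?_⟩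
  · refine natDegree_add_le_of_degree_le hA ((natDegree_C_mul_le _ _).trans ?_)
    refine (natDegree_prod_le _ _).trans ?_
    simp
  · intro j
    rw [Polynomial.map_add, Polynomial.map_mul, map_prod_orbit Θ hΘ, ← hG, eval_add, eval_mul,
      hGθ, mul_zero, add_zero, hval]
  · intro hd
    have h1 : (A + C θ * G).map (Θ k) - (A + C θ * G).map (Θ 0) =
        (A.map (Θ k) - A.map (Θ 0)) + C (Θ k θ - θ) * G := by
      simp only [Polynomial.map_add, Polynomial.map_mul, hG, map_prod_orbit Θ hΘ, map_C, h0, C_sub]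
      ring
    rw [h1, dvd_add_right hs] at hd
    have hu : IsUnit (C (Θ k θ - θ)) := by
      rw [isUnit_C, isUnit_iff_ne_zero, sub_ne_zero]
      exact fun h => hk (hθ (by simpa [h0] using h))
    exact hGn ((IsUnit.dvd_mul_left hu).1 hd)

end Interpolation

section Slice

variable {F : Type*} [Field F] {n : ℕ} [NeZero n]

/-- The slice of the hypersurface `∏ (t (j + 1) - t j) = c * ∏ (t (j + k) - t j)` by a pencil. -/
noncomputable def slicePoly (c : F) (k : ZMod n) (A B : ZMod n → F[X]) : F[X][X] :=
  ∏ j, (C (A (j + 1) - A j) + X * C (B (j + 1) - B j)) -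
    C (C c) * ∏ j, (C (A (j + k) - A j) + X * C (B (j + k) - B j))

variable {c : F} {k : ZMod n} {A B : ZMod n → F[X]}

theorem natDegree_slicePoly_le : (slicePoly c k A B).natDegree ≤ n := by
  have h : ∀ a b : ZMod n → F[X], (∏ j, (C (a j) + X * C (b j))).natDegree ≤ n := by
    intro a b
    simpa [ZMod.card] using natDegree_prod_linear_le Finset.univ a b
  exact natDegree_sub_le_of_le (h _ _) ((natDegree_C_mul_le _ _).trans (h _ _)) |>.trans (by simp)

theorem natDegree_coeff_slicePoly_le (hA : ∀ j, (A j).natDegree ≤ n)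
    (hB : ∀ j, (B j).natDegree ≤ n) (i : ℕ) : ((slicePoly c k A B).coeff i).natDegree ≤ n ^ 2 := by
  have h : ∀ l, ((∏ j, (C (A (j + l) - A j) + X * C (B (j + l) - B j))).coeff i).natDegree ≤
      n ^ 2 := by
    intro l
    have := natDegree_coeff_prod_linear_le Finset.univ (fun j => A (j + l) - A j)
      (fun j => B (j + l) - B j) (d := n)
      (fun j _ => (natDegree_sub_le_of_le (hA _) (hA _)).trans (by simp))
      (fun j _ => (natDegree_sub_le_of_le (hB _) (hB _)).trans (by simp)) i
    rwa [Finset.card_univ, ZMod.card, ← sq] at this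
  rw [slicePoly, coeff_sub, coeff_C_mul]
  refine (natDegree_sub_le_of_le (h 1) ((natDegree_C_mul_le _ _).trans (h k))).trans (by simp)

theorem coeff_slicePoly : (slicePoly c k A B).coeff n =
    ∏ j, (B (j + 1) - B j) - C c * ∏ j, (B (j + k) - B j) := by
  have h : ∀ l, (∏ j, (C (A (j + l) - A j) + X * C (B (j + l) - B j))).coeff n =
      ∏ j, (B (j + l) - B j) := by
    intro l
    have := coeff_card_prod_linear Finset.univ (fun j => A (j + l) - A j) fun j => B (j + l) - B j
    rwa [Finset.card_univ, ZMod.card] at this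
  rw [slicePoly, coeff_sub, coeff_C_mul, h, h]

theorem coeff_zero_slicePoly : (slicePoly c k A B).coeff 0 =
    ∏ j, (A (j + 1) - A j) - C c * ∏ j, (A (j + k) - A j) := by
  have h : ∀ l, (∏ j, (C (A (j + l) - A j) + X * C (B (j + l) - B j))).coeff 0 =
      ∏ j, (A (j + l) - A j) := fun l => coeff_zero_prod_linear Finset.univ _ _
  rw [slicePoly, coeff_sub, coeff_C_mul, h, h]

theorem bev_slicePoly (v u : F) : bev (RingHom.id F) v u (slicePoly c k A B) =
    ∏ j, (((A (j + 1)).eval v + u * (B (j + 1)).eval v) - ((A j).eval v + u * (B j).eval v)) -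
      c * ∏ j, (((A (j + k)).eval v + u * (B (j + k)).eval v) -
        ((A j).eval v + u * (B j).eval v)) := by
  have h : ∀ l, ∏ j, (bev (RingHom.id F) v u (C (A (j + l) - A j)) +
      bev (RingHom.id F) v u X * bev (RingHom.id F) v u (C (B (j + l) - B j))) =
      ∏ j, (((A (j + l)).eval v + u * (B (j + l)).eval v) -
        ((A j).eval v + u * (B j).eval v)) := by
    intro l
    refine Finset.prod_congr rfl fun j _ => ?_
    rw [bev_C, bev_C, bev_X, eval₂_id, eval₂_id, eval_sub, eval_sub]
    ring
  rw [slicePoly, map_sub, map_mul, map_prod, map_prod]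
  simp only [map_add, map_mul]
  rw [h, h, bev_C, eval₂_id, eval_C]

theorem map_slicePoly (ψ : F[X] →+* F[X]) {i : ZMod n} (hc : ψ (C c) = C c)
    (hA : ∀ j, ψ (A j) = A (i + j)) (hB : ∀ j, ψ (B j) = B (i + j)) :
    (slicePoly c k A B).map ψ = slicePoly c k A B := by
  have h : ∀ l, (∏ j, (C (A (j + l) - A j) + X * C (B (j + l) - B j))).map ψ =
      ∏ j, (C (A (j + l) - A j) + X * C (B (j + l) - B j)) := by
    intro l
    rw [Polynomial.map_prod]
    refine Fintype.prod_equiv (Equiv.addLeft i) _ _ fun j => ?_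
    rw [Polynomial.map_add, Polynomial.map_mul, map_C, map_C, map_X, map_sub ψ, map_sub ψ,
      hA, hA, hB, hB, Equiv.coe_addLeft, add_assoc]
  rw [slicePoly, Polynomial.map_sub, Polynomial.map_mul, map_C, hc, h, h]

theorem exists_slice_solution [Fintype F] (p e : ℕ) [Fact p.Prime] [CharP F p]
    (hcard : Fintype.card F = (p ^ e) ^ n) (hn : 5 ≤ n) (hq : 8 * n ^ 9 ≤ p ^ e)
    (Θ : ZMod n → F →+* F) (hΘ : ∀ i j x, Θ (i + j) x = Θ i (Θ j x)) (h0 : ∀ x, Θ 0 x = x)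
    (hfix1 : ∀ x, Θ 1 x = x → x ^ p ^ e = x) (hfix2 : ∀ x, x ^ p ^ e = x → ∀ j, Θ j x = x)
    {θ : F} (hθ : Function.Injective fun j => Θ j θ) {τ β : ZMod n → F} (hk0 : k ≠ 0)
    (hτk : τ k = τ 0) (hβk : β k = β 0) (hτ : ∀ j, j ≠ 0 → τ (j + k) ≠ τ j)
    (hβ : ∀ j, β (j + 1) ≠ β j) (hcount : ∃ s : Finset (ZMod n), n < 2 * s.card ∧
      ∀ j ∈ s, τ (j + 1) = τ j)
    (hτ1 : τ 1 = τ 0) (hτm : τ (-1) ≠ τ 0) (hc : c ^ p ^ e = c) (hc0 : c ≠ 0) :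
    ∃ t, t ^ p ^ e ≠ t ∧
      ∏ j, (Θ (j + 1) t - Θ j t) = c * ∏ j, (Θ (j + k) t - Θ j t) := by
  classical
  obtain ⟨s, hs, hsτ⟩ := hcount
  obtain ⟨A', hAdeg, hAval, hAs⟩ := exists_interpolation_simple Θ hΘ h0 hθ τ hk0
  obtain ⟨B', hBdeg, hBval⟩ := exists_interpolation Θ hΘ h0 hθ β
  set A : ZMod n → F[X] := fun j => A'.map (Θ j) with hA
  set B : ZMod n → F[X] := fun j => B'.map (Θ j) with hB
  have hAθ : ∀ j, (A j).eval θ = τ j := hAval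
  have hBθ : ∀ j, (B j).eval θ = β j := hBval
  set P := slicePoly c k A B with hP
  set h : F[X] := (A 1 - A 0) * (B (-1) - B 0) - (A (-1) - A 0) * (B 1 - B 0) with hh
  have hAd : ∀ j, (A j).natDegree ≤ n := fun j => natDegree_map_le.trans hAdeg
  have hBd : ∀ j, (B j).natDegree ≤ n := fun j => natDegree_map_le.trans hBdeg
  have hmap : ∀ (Q : F[X]) i j, (Q.map (Θ j)).map (Θ i) = Q.map (Θ (i + j)) := by
    intro Q i j
    rw [Polynomial.map_map]
    congr 1
    ext x
    rw [RingHom.comp_apply, hΘ]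
  have hhθ : h.eval θ ≠ 0 := by
    rw [hh]
    simp only [eval_sub, eval_mul, hAθ, hBθ, hτ1, sub_self, zero_mul, zero_sub]
    have := hβ 0
    rw [zero_add] at this
    exact neg_ne_zero.2 (mul_ne_zero (sub_ne_zero.2 hτm) (sub_ne_zero.2 this))
  have hPθ : P.map (evalRingHom θ) = ∏ j, (C (τ (j + 1) - τ j) + X * C (β (j + 1) - β j)) := by
    rw [hP, slicePoly, Polynomial.map_sub, Polynomial.map_mul, Polynomial.map_prod,
      Polynomial.map_prod, Finset.prod_eq_zero (Finset.mem_univ 0)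
        (f := fun j => Polynomial.map (evalRingHom θ)
          (C (A (j + k) - A j) + X * C (B (j + k) - B j))), mul_zero, sub_zero]
    · simp [hAθ, hBθ]
    · simp [hAθ, hBθ, hτk, hβk]
  obtain ⟨v, hv, hhv, hvP⟩ := exists_rational_point_finite p e (n := n) (k := s.card) (h := h)
    (P := P) (θ := θ) hcard (by rintro h; simp [h] at hhθ) (by
      have e1 : ∀ a b c d : F[X], a.natDegree ≤ n → b.natDegree ≤ n → c.natDegree ≤ n →
          d.natDegree ≤ n → ((a - b) * (c - d)).natDegree ≤ 2 * n := by
        intro a b c d ha hb hc hd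
        have h1 := natDegree_sub_le_of_le ha hb
        have h2 := natDegree_sub_le_of_le hc hd
        rw [max_self] at h1 h2
        exact natDegree_mul_le.trans (by omega)
      exact (natDegree_sub_le_of_le (e1 _ _ _ _ (hAd _) (hAd _) (hBd _) (hBd _))
        (e1 _ _ _ _ (hAd _) (hAd _) (hBd _) (hBd _))).trans (by simp)) hn hq
    natDegree_slicePoly_le (natDegree_coeff_slicePoly_le hAd hBd) (by
      intro j a
      apply hfix1
      have := map_slicePoly (c := c) (k := k) (A := A) (B := B) (mapRingHom (Θ 1)) (i := 1)
        (by simp [hfix2 c hc]) (fun j => hmap _ _ _) (fun j => hmap _ _ _)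
      have h1 := congrArg (fun Q : F[X][X] => (Q.coeff j).coeff a) this
      simpa [coeff_map] using h1) (by
      have h1 := congrArg (fun Q : F[X] => Q.coeff n) hPθ
      simp only [coeff_map, coe_evalRingHom] at h1
      have h2 := coeff_card_prod_linear Finset.univ (fun j => τ (j + 1) - τ j)
        fun j => β (j + 1) - β j
      rw [Finset.card_univ, ZMod.card] at h2
      rw [h1, h2]
      exact Finset.prod_ne_zero_iff.2 fun j _ => sub_ne_zero.2 (hβ j)) hs (by
      intro i hi
      have h1 := congrArg (fun Q : F[X] => Q.coeff i) hPθ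
      simp only [coeff_map, coe_evalRingHom] at h1
      rw [h1]
      refine X_pow_dvd_iff.1 (X_pow_dvd_prod_linear Finset.univ _ _) i (hi.trans_le ?_)
      refine Finset.card_le_card fun j hj => ?_
      simp [hsτ j hj]) (by
      rw [hP, coeff_zero_slicePoly]
      have h1 : (X - C θ) ^ 2 ∣ ∏ j, (A (j + 1) - A j) := by
        refine (pow_dvd_pow _ (show 2 ≤ s.card by omega)).trans ?_
        rw [← Finset.prod_const]
        refine (Finset.prod_dvd_prod_of_dvd _ (fun j => A (j + 1) - A j) fun j hj => ?_).trans
          (Finset.prod_dvd_prod_of_subset _ _ _ (Finset.subset_univ s))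
        rw [dvd_iff_isRoot, IsRoot, eval_sub, hAθ, hAθ, hsτ j hj, sub_self]
      rw [dvd_sub_right h1, IsUnit.dvd_mul_left (isUnit_C.2 hc0.isUnit),
        ← Finset.mul_prod_erase _ _ (Finset.mem_univ 0), zero_add]
      intro hd
      refine hAs ((prime_X_sub_C θ).pow_dvd_of_dvd_mul_right 2 ?_ hd)
      rw [dvd_iff_isRoot, IsRoot, eval_prod, Finset.prod_eq_zero_iff]
      rintro ⟨j, hj, hj0⟩
      rw [eval_sub, hAθ, hAθ, sub_eq_zero] at hj0
      exact hτ j (Finset.ne_of_mem_erase hj) hj0)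
  have hΘeval : ∀ (Q : F[X]) j, Θ j (Q.eval v) = (Q.map (Θ j)).eval v := by
    intro Q j
    have := eval_map_apply (Θ j) (p := Q) v
    rw [hfix2 v hv] at this
    exact this.symm
  have hneg : ∀ t, t ^ p ^ e = t → Θ 1 t = Θ 0 t ∧ Θ (-1) t = Θ 0 t := by
    intro t ht
    simp only [hfix2 t ht, and_self]
  rcases hvP with hκ | ⟨u, hu, huP⟩
  · refine ⟨B'.eval v, fun ht => hhv ?_, ?_⟩
    · obtain ⟨h1, h2⟩ := hneg _ ht
      simp only [hΘeval] at h1 h2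
      have e1 : (B 1).eval v = (B 0).eval v := h1
      have e2 : (B (-1)).eval v = (B 0).eval v := h2
      rw [hh]
      simp [e1, e2]
    · rw [hP, coeff_slicePoly, eval_sub, eval_mul, eval_prod, eval_prod, eval_C, sub_eq_zero] at hκ
      simpa only [eval_sub, hΘeval] using hκ
  · have hΘt : ∀ j, Θ j (A'.eval v + u * B'.eval v) = (A j).eval v + u * (B j).eval v := by
      intro j
      rw [map_add, map_mul, hΘeval, hΘeval, hfix2 u hu]
    refine ⟨A'.eval v + u * B'.eval v, fun ht => hhv ?_, ?_⟩
    · obtain ⟨h1, h2⟩ := hneg _ ht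
      rw [hΘt, hΘt] at h1 h2
      rw [hh]
      simp only [eval_sub, eval_mul]
      linear_combination ((B (-1)).eval v - (B 0).eval v) * h1 - ((B 1).eval v - (B 0).eval v) * h2
    · rw [hP, bev_slicePoly, sub_eq_zero] at huP
      simpa only [hΘt] using huP

end Slice

section FrobeniusPowers

variable {F : Type*} [Field F]

theorem pow_pow_mod_of_card [Fintype F] {q n : ℕ} (hcard : Fintype.card F = q ^ n) (m : ℕ) (x : F) :
    x ^ q ^ (m % n) = x ^ q ^ m := by
  conv_rhs => rw [← Nat.mod_add_div m n, pow_add, pow_mul, pow_mul, ← hcard]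
  exact (FiniteField.pow_card_pow _ _).symm

theorem pow_eq_self_of_coprime [Fintype F] {q n g : ℕ} (hcard : Fintype.card F = q ^ n)
    (hg : Nat.Coprime g n) {x : F} (hx : x ^ q ^ g = x) : x ^ q = x := by
  have hiter : ∀ m (y : F), (fun z : F => z ^ q)^[m] y = y ^ q ^ m := by
    intro m
    induction m with
    | zero => simp
    | succ m ih => intro y; rw [Function.iterate_succ_apply, ih, ← pow_mul, ← pow_succ']
  have h1 : Function.IsPeriodicPt (fun z : F => z ^ q) g x := (hiter g x).trans hx
  have h2 : Function.IsPeriodicPt (fun z : F => z ^ q) n x :=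
    (hiter n x).trans (by rw [← hcard, FiniteField.pow_card])
  have h3 := h1.gcd h2
  rw [hg] at h3
  simpa [Function.IsPeriodicPt, Function.IsFixedPt] using h3

theorem pow_pow_eq_self {q : ℕ} {x : F} (hx : x ^ q = x) (m : ℕ) : x ^ q ^ m = x := by
  induction m with
  | zero => simp
  | succ m ih => rw [pow_succ, pow_mul, ih, hx]

theorem exists_pow_ne_self [Fintype F] {q n : ℕ} (hq : 2 ≤ q) (hn : 2 ≤ n)
    (hcard : Fintype.card F = q ^ n) : ∃ x : F, x ^ q ≠ x := by
  classical
  by_contra! h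
  have hne : (X ^ q - X : F[X]) ≠ 0 := FiniteField.X_pow_card_sub_X_ne_zero F (by omega)
  have h1 : (Finset.univ : Finset F).card ≤ (X ^ q - X : F[X]).natDegree := by
    refine card_le_degree_of_subset_roots fun x _ => ?_
    rw [Polynomial.mem_roots hne]
    simp [h x]
  rw [FiniteField.X_pow_card_sub_X_natDegree_eq F (by omega), Finset.card_univ, hcard] at h1
  exact absurd h1 (not_le.2 (by simpa using Nat.pow_lt_pow_right (by omega : 1 < q) (by omega : 1 <
    n)))

end FrobeniusPowers

section ArcCount

variable {n : ℕ} [NeZero n]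

theorem ZMod.val_add_one_cases (j : ZMod n) (hn : 2 ≤ n) :
    (j + 1).val = if j.val + 1 = n then 0 else j.val + 1 := by
  have := j.val_lt
  have h1 : (1 : ZMod n).val = 1 := by
    have : Fact (1 < n) := ⟨hn⟩
    exact ZMod.val_one n
  rw [ZMod.val_add, h1]
  split_ifs with h
  · rw [h, Nat.mod_self]
  · exact Nat.mod_eq_of_lt (by omega)

theorem ZMod.val_add_natCast_cases (j : ZMod n) {k : ℕ} (hk : k < n) :
    (j + k).val = if j.val + k < n then j.val + k else j.val + k - n := by
  have := j.val_lt
  rw [ZMod.val_add, ZMod.val_natCast, Nat.mod_eq_of_lt hk]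
  split_ifs with h
  · exact Nat.mod_eq_of_lt h
  · rw [Nat.mod_eq_sub_mod (by omega), Nat.mod_eq_of_lt (by omega)]

theorem exists_finset_arc {k : ℕ} (hn : 5 ≤ n) (hodd : Odd n) (hk : 2 ≤ k) :
    ∃ s : Finset (ZMod n), n < 2 * s.card ∧
      ∀ j ∈ s, ((j + 1).val - 1) / k = (j.val - 1) / k := by
  classical
  set bad : Finset (ZMod n) :=
    Finset.univ.filter fun j => ¬ ((j + 1).val - 1) / k = (j.val - 1) / k with hbad
  refine ⟨badᶜ, ?_, fun j hj => ?_⟩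
  · have hsub : bad.image ZMod.val ⊆ insert (n - 1) ((Finset.Ioc 0 (n - 2)).filter (k ∣ ·)) := by
      intro i hi
      obtain ⟨j, hj, rfl⟩ := Finset.mem_image.1 hi
      rw [hbad, Finset.mem_filter] at hj
      have hlt := j.val_lt
      have h1 := ZMod.val_add_one_cases j (by omega)
      rw [Finset.mem_insert, Finset.mem_filter, Finset.mem_Ioc]
      by_cases hj1 : j.val + 1 = n
      · left; omega
      · right
        rw [if_neg hj1] at h1
        have h2 := hj.2
        rw [h1, Nat.add_sub_cancel] at h2
        have h0 : j.val ≠ 0 := by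
          intro h0
          rw [h0] at h2
          simp at h2
        refine ⟨by omega, ?_⟩
        by_contra hd
        apply h2
        have := Nat.succ_div_of_not_dvd (a := j.val - 1) (b := k)
          (by rwa [show j.val - 1 + 1 = j.val by omega])
        rwa [show j.val - 1 + 1 = j.val by omega] at this
    have h3 : bad.card ≤ (n - 2) / k + 1 := by
      rw [← Finset.card_image_of_injective bad (ZMod.val_injective n)]
      refine (Finset.card_le_card hsub).trans ((Finset.card_insert_le _ _).trans ?_)
      rw [Nat.Ioc_filter_dvd_card_eq_div]
    have h4 : (n - 2) / k ≤ (n - 2) / 2 := Nat.div_le_div_left hk (by norm_num)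
    rw [Finset.card_compl, ZMod.card]
    obtain ⟨m, rfl⟩ := hodd
    omega
  · rw [Finset.mem_compl, hbad, Finset.mem_filter, not_and, not_not] at hj
    exact hj (Finset.mem_univ j)

end ArcCount

theorem prod_zmod_val {M : Type*} [CommMonoid M] {n : ℕ} [NeZero n] (φ : ℕ → M) :
    ∏ j : ZMod n, φ j.val = ∏ i ∈ Finset.range n, φ i := by
  refine Finset.prod_bij (fun j _ => j.val) (fun j _ => Finset.mem_range.2 j.val_lt)
    (fun j _ j' _ h => ZMod.val_injective n h) (fun i hi => ⟨i, Finset.mem_univ _, ?_⟩)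
    fun j _ => rfl
  rw [ZMod.val_natCast, Nat.mod_eq_of_lt (Finset.mem_range.1 hi)]

theorem exists_frobenius_slice {F : Type*} [Field F] [Fintype F] {p e n g k : ℕ} [Fact p.Prime]
    [CharP F p] (hnp : n.Prime)
    (hcard : Fintype.card F = (p ^ e) ^ n) (hn : 5 ≤ n) (hq : 8 * n ^ 9 ≤ p ^ e)
    (hg : 1 ≤ g) (hgn : g < n) (hk : 2 ≤ k) (hkn : 2 * k < n) {c : F} (hc : c ^ p ^ e = c)
    (hc0 : c ≠ 0) :
    ∃ t : F, t ^ p ^ e ≠ t ∧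
      ∏ j ∈ Finset.range n, (t ^ (p ^ e) ^ (g * (j + 1)) - t ^ (p ^ e) ^ (g * j)) =
        c * ∏ j ∈ Finset.range n, (t ^ (p ^ e) ^ (g * (j + k)) - t ^ (p ^ e) ^ (g * j)) := by
  have : NeZero n := ⟨by omega⟩
  have hcop : Nat.Coprime g n := (Nat.coprime_of_lt_prime (by omega) hgn hnp).symm
  have hmod : ∀ {a b : ℕ}, a ≡ b [MOD n] → ∀ x : F, x ^ (p ^ e) ^ a = x ^ (p ^ e) ^ b := by
    intro a b hab x
    rw [← pow_pow_mod_of_card hcard a, ← pow_pow_mod_of_card hcard b, hab]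
  have hval : ∀ (j : ZMod n) (m : ℕ), (j + m).val ≡ j.val + m [MOD n] := by
    intro j m
    rw [← ZMod.natCast_eq_natCast_iff]
    simp
  obtain ⟨θ, hθ⟩ := exists_pow_ne_self (F := F) (q := p ^ e) (n := n)
    (by have := Nat.pow_le_pow_left hn 9; omega) (by omega) hcard
  set Θ : ZMod n → F →+* F := fun j => iterateFrobenius F p (e * (g * j.val)) with hΘdef
  have hΘapp : ∀ j x, Θ j x = x ^ (p ^ e) ^ (g * j.val) := by
    intro j x
    rw [hΘdef]
    simp only [iterateFrobenius_def, pow_mul]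
  have hΘnat : ∀ j (m : ℕ) x, Θ (j + m) x = x ^ (p ^ e) ^ (g * (j.val + m)) := by
    intro j m x
    rw [hΘapp]
    exact hmod ((hval j m).mul_left g) x
  set γ : ℕ → F := fun i => θ ^ (p ^ e) ^ (g * i) with hγ
  have hγne : ∀ i i', i < i' → i' < n → γ i ≠ γ i' := by
    intro i i' h h' heq
    refine hθ (pow_eq_self_of_coprime (g := g * (i' - i)) hcard ?_ ?_)
    · exact hcop.mul_left (Nat.coprime_of_lt_prime (by omega) (by omega) hnp).symm
    · apply (iterateFrobenius F p (e * (g * i))).injective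
      rw [iterateFrobenius_def, iterateFrobenius_def, pow_mul p, ← pow_mul θ, ← pow_add,
        ← mul_add, Nat.sub_add_cancel h.le]
      exact heq.symm
  have hγinj : ∀ {i i'}, i < n → i' < n → i ≠ i' → γ i ≠ γ i' := by
    intro i i' hi hi' hne
    rcases lt_or_gt_of_ne hne with h | h
    · exact hγne i i' h hi'
    · exact (hγne i' i h hi).symm
  have hk0 : ((k : ℕ) : ZMod n).val = k := by
    rw [ZMod.val_natCast, Nat.mod_eq_of_lt (by omega)]
  have harc : ∀ i, i < n → (i - 1) / k < n := fun i hi =>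
    (Nat.div_le_self _ _).trans_lt (by omega)
  obtain ⟨s, hs, hs'⟩ := exists_finset_arc (n := n) hn (hnp.odd_of_ne_two (by omega)) hk
  suffices key : ∃ t : F, t ^ p ^ e ≠ t ∧
      ∏ j, (Θ (j + 1) t - Θ j t) = c * ∏ j, (Θ (j + (k : ZMod n)) t - Θ j t) by
    obtain ⟨t, ht, heq⟩ := key
    refine ⟨t, ht, ?_⟩
    rw [← prod_zmod_val fun j => t ^ (p ^ e) ^ (g * (j + 1)) - t ^ (p ^ e) ^ (g * j),
      ← prod_zmod_val fun j => t ^ (p ^ e) ^ (g * (j + k)) - t ^ (p ^ e) ^ (g * j)]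
    simp only [← hΘnat, ← hΘapp, Nat.cast_one]
    exact heq
  refine exists_slice_solution (n := n) (c := c) (k := (k : ZMod n)) p e hcard hn hq
    Θ ?_ ?_ ?_ ?_ (θ := θ) ?_ (τ := fun j => γ ((j.val - 1) / k))
    (β := fun j => γ (if j.val = k then 0 else j.val)) ?_ ?_ ?_ ?_ ?_ ⟨s, hs, ?_⟩ ?_ ?_ hc hc0
  · intro i j x
    rw [hΘapp, hΘapp, hΘapp, ← pow_mul x, ← pow_add, ← mul_add, add_comm j.val]
    refine hmod (Nat.ModEq.mul_left g ?_) x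
    rw [ZMod.val_add]
    exact Nat.mod_modEq _ _
  · intro x
    rw [hΘapp]
    simp
  · intro x hx
    refine pow_eq_self_of_coprime (g := g) hcard hcop ?_
    have h1 := hΘnat 0 1 x
    rw [Nat.cast_one, zero_add, hx, ZMod.val_zero, zero_add, mul_one] at h1
    exact h1.symm
  · intro x hx j
    rw [hΘapp, pow_pow_eq_self hx]
  · intro i j h
    by_contra hne
    refine hγinj i.val_lt j.val_lt (fun h => hne (ZMod.val_injective n h)) ?_
    simpa only [hΘapp] using h
  · intro h
    rw [h, ZMod.val_zero] at hk0
    omega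
  · simp only [hk0, ZMod.val_zero]
    rw [Nat.div_eq_of_lt (by omega), Nat.div_eq_of_lt (by omega)]
  · simp [hk0]
  · intro j hj
    have hj0 : j.val ≠ 0 := (ZMod.val_ne_zero j).2 hj
    have hjn := j.val_lt
    refine hγinj (harc _ (ZMod.val_lt _)) (harc _ (ZMod.val_lt _)) ?_
    rw [ZMod.val_add_natCast_cases j (by omega : k < n)]
    split_ifs with h
    · rw [show j.val + k - 1 = j.val - 1 + k by omega, Nat.add_div_right _ (by omega)]
      omega
    · rw [Nat.div_eq_of_lt (a := j.val + k - n - 1) (by omega)]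
      exact (Nat.div_pos (by omega) (by omega)).ne
  · intro j
    have hjn := j.val_lt
    have h1 := ZMod.val_add_one_cases j (by omega)
    refine hγinj ?_ ?_ ?_ <;> split_ifs at * <;> omega
  · intro j hj
    simp only [hs' j hj]
  · simp only [ZMod.val_zero]
    have h1 := ZMod.val_add_one_cases (0 : ZMod n) (by omega)
    rw [zero_add, ZMod.val_zero, if_neg (by omega)] at h1
    rw [h1]
  · have h1 := ZMod.val_add_one_cases (-1 : ZMod n) (by omega)
    have h2 := (-1 : ZMod n).val_lt
    rw [neg_add_cancel, ZMod.val_zero] at h1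
    refine hγinj (harc _ (ZMod.val_lt _)) (harc _ (ZMod.val_lt _)) ?_
    rw [ZMod.val_zero, Nat.div_eq_of_lt (a := 0 - 1) (by omega)]
    refine (Nat.div_pos ?_ (by omega)).ne'
    split_ifs at h1
    omega

section FiniteFieldNorm

variable {F : Type*} [Field F] [Fintype F]

omit [Fintype F] in
theorem prod_pow_pow_eq_pow {q n : ℕ} (hq : 2 ≤ q) (z : F) :
    ∏ i ∈ Finset.range n, z ^ q ^ i = z ^ ((q ^ n - 1) / (q - 1)) := by
  rw [Finset.prod_pow_eq_pow_sum, Nat.geomSum_eq hq]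

theorem prod_pow_pow_mul_eq_pow {q n g : ℕ} [NeZero n] (hq : 2 ≤ q)
    (hcard : Fintype.card F = q ^ n) (hg : Nat.Coprime g n) (z : F) :
    ∏ i ∈ Finset.range n, z ^ q ^ (g * i) = z ^ ((q ^ n - 1) / (q - 1)) := by
  rw [← prod_pow_pow_eq_pow hq, ← prod_zmod_val, ← prod_zmod_val]
  refine Fintype.prod_equiv (Units.mulLeft (ZMod.unitOfCoprime g hg)) _ _ fun j => ?_
  rw [Units.mulLeft_apply, ZMod.coe_unitOfCoprime, ZMod.val_mul, ZMod.val_natCast,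
    Nat.mod_mul_mod, pow_pow_mod_of_card hcard]

theorem pow_norm_pow_eq {q n : ℕ} (hq : 2 ≤ q) (hn : n ≠ 0) (hcard : Fintype.card F = q ^ n)
    (z : F) : (z ^ ((q ^ n - 1) / (q - 1))) ^ q = z ^ ((q ^ n - 1) / (q - 1)) := by
  set M := (q ^ n - 1) / (q - 1) with hM
  have hMq : M * (q - 1) = q ^ n - 1 :=
    Nat.div_mul_cancel (by simpa using Nat.sub_dvd_pow_sub_pow q 1 n)
  have hqn : 2 ≤ q ^ n := hq.trans (Nat.le_self_pow hn q)
  have hM1 : M ≠ 0 := by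
    rintro h
    rw [h, zero_mul] at hMq
    omega
  have h1 : M * q = q ^ n + (M - 1) := by
    obtain ⟨r, rfl⟩ : ∃ r, q = r + 1 := ⟨q - 1, by omega⟩
    rw [Nat.add_sub_cancel] at hMq
    rw [mul_add, hMq]
    omega
  rw [← pow_mul, h1, pow_add, ← hcard, FiniteField.pow_card, ← pow_succ',
    Nat.sub_add_cancel (Nat.pos_of_ne_zero hM1)]

theorem pow_pow_norm_eq {q n : ℕ} (hq : 2 ≤ q) (hn : n ≠ 0) (hcard : Fintype.card F = q ^ n)
    (z : F) (i : ℕ) : (z ^ q ^ i) ^ ((q ^ n - 1) / (q - 1)) = z ^ ((q ^ n - 1) / (q - 1)) := by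
  rw [← pow_mul, mul_comm, pow_mul, pow_pow_eq_self (pow_norm_pow_eq hq hn hcard z)]

variable {p e : ℕ} [Fact p.Prime] [CharP F p]

omit [Fintype F] in
theorem neg_pow_pow_char (z : F) (i : ℕ) : (-z) ^ (p ^ e) ^ i = -z ^ (p ^ e) ^ i := by
  rw [← pow_mul]
  exact map_neg (iterateFrobenius F p (e * i)) z

omit [Fintype F] in
theorem sub_pow_pow_char (x y : F) (i : ℕ) :
    (x - y) ^ (p ^ e) ^ i = x ^ (p ^ e) ^ i - y ^ (p ^ e) ^ i := by
  rw [← pow_mul]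
  exact map_sub (iterateFrobenius F p (e * i)) x y

omit [Fintype F] in
theorem neg_pow_norm {n : ℕ} (hq : 2 ≤ p ^ e) (hn : Odd n) (z : F) :
    (-z) ^ (((p ^ e) ^ n - 1) / (p ^ e - 1)) = -z ^ (((p ^ e) ^ n - 1) / (p ^ e - 1)) := by
  rw [← prod_pow_pow_eq_pow hq, ← prod_pow_pow_eq_pow hq]
  simp only [neg_pow_pow_char, Finset.prod_neg, Finset.card_range, hn.neg_one_pow, neg_one_mul]

theorem norm_pow_sub_complement {n i j : ℕ} (hq : 2 ≤ p ^ e) (hn : Odd n)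
    (hcard : Fintype.card F = (p ^ e) ^ n) (hij : (i + j) % n = 0) (t : F) :
    (t ^ (p ^ e) ^ j - t) ^ (((p ^ e) ^ n - 1) / (p ^ e - 1)) =
      -(t ^ (p ^ e) ^ i - t) ^ (((p ^ e) ^ n - 1) / (p ^ e - 1)) := by
  rw [← neg_pow_norm hq hn, ← pow_pow_norm_eq hq hn.pos.ne' hcard (t ^ (p ^ e) ^ j - t) i,
    sub_pow_pow_char, ← pow_mul, ← pow_add, add_comm j, ← pow_pow_mod_of_card hcard (i + j), hij,
    pow_zero, pow_one, neg_sub]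

theorem exists_norm_pow_sub_eq {n g k : ℕ} (hnp : n.Prime)
    (hcard : Fintype.card F = (p ^ e) ^ n) (hn : 5 ≤ n) (hq : 8 * n ^ 9 ≤ p ^ e)
    (hg : 1 ≤ g) (hgn : g < n) (hk : 2 ≤ k) (hkn : 2 * k < n) {c : F} (hc : c ^ p ^ e = c)
    (hc0 : c ≠ 0) :
    ∃ t : F, t ^ p ^ e ≠ t ∧
      (t ^ (p ^ e) ^ g - t) ^ (((p ^ e) ^ n - 1) / (p ^ e - 1)) =
        c * (t ^ (p ^ e) ^ (g * k) - t) ^ (((p ^ e) ^ n - 1) / (p ^ e - 1)) := by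
  obtain ⟨t, ht, h⟩ := exists_frobenius_slice hnp hcard hn hq hg hgn hk hkn hc hc0
  refine ⟨t, ht, ?_⟩
  have : NeZero n := ⟨by omega⟩
  have hq2 : 2 ≤ p ^ e := by have := Nat.pow_le_pow_left hn 9; omega
  have hcop : Nat.Coprime g n := (Nat.coprime_of_lt_prime (by omega) hgn hnp).symm
  have key : ∀ l, ∏ j ∈ Finset.range n, (t ^ (p ^ e) ^ (g * (j + l)) - t ^ (p ^ e) ^ (g * j)) =
      (t ^ (p ^ e) ^ (g * l) - t) ^ (((p ^ e) ^ n - 1) / (p ^ e - 1)) := by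
    intro l
    rw [← prod_pow_pow_mul_eq_pow hq2 hcard hcop]
    refine Finset.prod_congr rfl fun j _ => ?_
    rw [sub_pow_pow_char, ← pow_mul t, ← pow_add, ← mul_add, add_comm l]
  rw [key, key, mul_one] at h
  exact h

theorem exists_norm_pow_sub_eq_of_add_ne {n I J : ℕ} (hnp : n.Prime)
    (hcard : Fintype.card F = (p ^ e) ^ n) (hn : 5 ≤ n) (hq : 8 * n ^ 9 ≤ p ^ e)
    (hI : 1 ≤ I) (hIJ : I < J) (hJ : J < n) (hsum : I + J ≠ n) {c : F} (hc : c ^ p ^ e = c)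
    (hc0 : c ≠ 0) :
    ∃ t : F, t ^ p ^ e ≠ t ∧
      (t ^ (p ^ e) ^ I - t) ^ (((p ^ e) ^ n - 1) / (p ^ e - 1)) =
        c * (t ^ (p ^ e) ^ J - t) ^ (((p ^ e) ^ n - 1) / (p ^ e - 1)) := by
  have hodd : Odd n := hnp.odd_of_ne_two (by omega)
  have hq2 : 2 ≤ p ^ e := by have := Nat.pow_le_pow_left hn 9; omega
  have hcop : Nat.Coprime I n := (Nat.coprime_of_lt_prime (by omega) (by omega) hnp).symm
  obtain ⟨m, hmn, hm⟩ : ∃ m < n, I * m % n = J := by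
    obtain ⟨m, hmn, hm⟩ := Nat.exists_mul_mod_eq_of_coprime J hcop (by omega)
    exact ⟨m, hmn, hm.trans (Nat.mod_eq_of_lt hJ)⟩
  have hm0 : m ≠ 0 := by
    rintro rfl
    simp at hm
    omega
  have hm1 : m ≠ 1 := by
    rintro rfl
    rw [mul_one, Nat.mod_eq_of_lt (by omega)] at hm
    omega
  have hcomp : (J + I * (n - m)) % n = 0 := by
    rw [← hm, Nat.mod_add_mod, ← mul_add, Nat.add_sub_cancel' hmn.le, Nat.mul_mod_left]
  have hmn1 : m ≠ n - 1 := by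
    intro h
    rw [h, show n - (n - 1) = 1 by omega, mul_one] at hcomp
    have := Nat.le_of_dvd (by omega) (Nat.dvd_of_mod_eq_zero hcomp)
    have h2 : (J + I - n) % n = 0 := by
      rw [← Nat.mod_eq_sub_mod this]; exact hcomp
    rw [Nat.mod_eq_of_lt (by omega)] at h2
    omega
  rcases lt_or_ge (2 * m) n with h | h
  · obtain ⟨t, ht, heq⟩ := exists_norm_pow_sub_eq hnp hcard hn hq hI (hIJ.trans hJ)
      (by omega : 2 ≤ m) h hc hc0
    refine ⟨t, ht, heq.trans ?_⟩
    rw [← pow_pow_mod_of_card hcard (I * m), hm]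
  · have hne : n ≠ 2 * m := by
      rintro h
      exact absurd hodd (Nat.not_odd_iff_even.2 (h ▸ even_two_mul m))
    obtain ⟨t, ht, heq⟩ := exists_norm_pow_sub_eq hnp hcard hn hq hI (hIJ.trans hJ)
      (by omega : 2 ≤ n - m) (by omega) (c := -c)
      (by simpa [hc] using neg_pow_pow_char (p := p) (e := e) c 1) (neg_ne_zero.2 hc0)
    refine ⟨t, ht, heq.trans ?_⟩
    rw [norm_pow_sub_complement hq2 hodd hcard hcomp, neg_mul_neg]

omit [Fact p.Prime] [CharP F p] in
theorem sub_ne_zero_of_pow_ne {n i : ℕ} (hnp : n.Prime)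
    (hcard : Fintype.card F = (p ^ e) ^ n) (hi : 1 ≤ i) (hin : i < n) {t : F}
    (ht : t ^ p ^ e ≠ t) : t ^ (p ^ e) ^ i - t ≠ 0 := fun h =>
  ht (pow_eq_self_of_coprime hcard (Nat.coprime_of_lt_prime (by omega) hin hnp).symm
    (sub_eq_zero.1 h))

omit [Fact p.Prime] [CharP F p] in
theorem exists_pow_eq_of_pow_eq_one {m d : ℕ} (hd : (Fintype.card F - 1).gcd m = d) (hd0 : d ≠ 0)
    {z : F} (hz0 : z ≠ 0) (hz : z ^ ((Fintype.card F - 1) / d) = 1) : ∃ y : F, y ≠ 0 ∧ y ^ m = z :=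
      by
  classical
  have hN : Fintype.card F - 1 = orderOf (IsCyclic.exists_generator (α := Fˣ)).choose := by
    rw [orderOf_eq_card_of_forall_mem_zpowers (IsCyclic.exists_generator (α := Fˣ)).choose_spec,
      Nat.card_eq_fintype_card, Fintype.card_units]
  set u := (IsCyclic.exists_generator (α := Fˣ)).choose
  obtain ⟨a, ha⟩ := (IsCyclic.exists_generator (α := Fˣ)).choose_spec (Units.mk0 z hz0)
  change u ^ a = _ at ha
  set N := Fintype.card F - 1
  have hNpos : 0 < N := Nat.sub_pos_of_lt Fintype.one_lt_card
  have hdN : d ∣ N := hd ▸ Nat.gcd_dvd_left N m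
  have h1 : (N : ℤ) ∣ a * (N / d : ℕ) := by
    rw [hN, orderOf_dvd_iff_zpow_eq_one, zpow_mul, ha, ← hN, zpow_natCast]
    ext
    simpa using hz
  have h2 : (d : ℤ) ∣ a := by
    obtain ⟨r, hr⟩ := hdN
    have hr0 : r ≠ 0 := by
      rintro rfl
      omega
    rw [hr, Nat.mul_div_cancel_left _ (Nat.pos_of_ne_zero hd0), Nat.cast_mul] at h1
    exact Int.dvd_of_mul_dvd_mul_right (by exact_mod_cast hr0) h1
  obtain ⟨b, rfl⟩ := h2
  refine ⟨(u ^ (N.gcdB m * b) : Fˣ), Units.ne_zero _, ?_⟩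
  have h3 : (u ^ (N.gcdB m * b)) ^ m = Units.mk0 z hz0 := by
    rw [← ha, ← hd, Nat.gcd_eq_gcd_ab, ← zpow_natCast, ← zpow_mul, add_mul, zpow_add,
      mul_assoc (N : ℤ), zpow_mul u (N : ℤ), zpow_natCast, hN, pow_orderOf_eq_one, one_zpow,
        one_mul]
    congr 1
    ring
  rw [← Units.val_pow_eq_pow_val, h3, Units.val_mk0]

end FiniteFieldNorm

theorem pow_twentySeven_le_two_pow {n : ℕ} (hn : 5 ≤ n) : n ^ 27 ≤ 2 ^ (13 * n + 3) := by
  induction n, hn using Nat.le_induction with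
  | base => norm_num
  | succ n hn ih =>
    have h1 : (5 * (n + 1)) ^ 27 ≤ (6 * n) ^ 27 := Nat.pow_le_pow_left (by omega) 27
    rw [mul_pow, mul_pow] at h1
    have h2 : (2 : ℕ) ^ (13 * (n + 1) + 3) = 2 ^ 13 * 2 ^ (13 * n + 3) := by
      rw [← pow_add]
      congr 1
      ring
    rw [h2]
    generalize (n + 1) ^ 27 = a at h1 ⊢
    generalize n ^ 27 = b at h1 ih
    generalize 2 ^ (13 * n + 3) = c at ih ⊢
    norm_num at h1 ⊢
    omega

theorem eight_mul_pow_nine_le_of_two_rpow_le {n q : ℕ} (hn : 5 ≤ n)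
    (h : (2 : ℝ) ^ ((13 / 3 : ℝ) * (n : ℝ) + 4) ≤ (q : ℝ)) : 8 * n ^ 9 ≤ q := by
  have h1 : ((2 : ℝ) ^ ((13 / 3 : ℝ) * (n : ℝ) + 4)) ^ 3 ≤ (q : ℝ) ^ 3 :=
    pow_le_pow_left₀ (by positivity) h 3
  have h2 : ((2 : ℝ) ^ ((13 / 3 : ℝ) * (n : ℝ) + 4)) ^ 3 = (2 : ℝ) ^ (13 * n + 12) := by
    rw [← Real.rpow_natCast, ← Real.rpow_natCast, ← Real.rpow_mul (by norm_num)]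
    congr 1
    push_cast
    ring
  rw [h2] at h1
  have h3 : 2 ^ (13 * n + 12) ≤ q ^ 3 := by exact_mod_cast h1
  refine (Nat.pow_le_pow_iff_left (n := 3) (by norm_num)).1 (le_trans ?_ h3)
  calc (8 * n ^ 9) ^ 3 = 2 ^ 9 * n ^ 27 := by ring
    _ ≤ 2 ^ 9 * 2 ^ (13 * n + 3) := Nat.mul_le_mul_left _ (pow_twentySeven_le_two_pow hn)
    _ = 2 ^ (13 * n + 12) := by
      rw [← pow_add]
      congr 1
      ring

theorem gcd_pow_sub_one_pow_sub_pow {q n I J : ℕ} (hq : 2 ≤ q) (hnp : n.Prime) (hIJ : I < J)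
    (hJ : J < n) : (q ^ n - 1).gcd (q ^ J - q ^ I) = q - 1 := by
  have h1 : q ^ J - q ^ I = q ^ I * (q ^ (J - I) - 1) := by
    rw [Nat.mul_sub, ← pow_add, Nat.add_sub_cancel' hIJ.le, mul_one]
  have h2 : Nat.Coprime (q ^ n - 1) (q ^ I) := by
    refine Nat.Coprime.pow_right I ?_
    have h3 : q ^ n = q ^ n - 1 + 1 := by
      have : 0 < q ^ n := by positivity
      omega
    refine Nat.Coprime.symm (Nat.Coprime.coprime_dvd_left (dvd_pow_self q hnp.ne_zero) ?_)
    rw [h3, Nat.add_sub_cancel]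
    exact (Nat.coprime_self_add_left.2 (Nat.coprime_one_left _))
  rw [h1, h2.symm.gcd_mul_left_cancel_right, Nat.pow_sub_one_gcd_pow_sub_one,
    (Nat.coprime_of_lt_prime (by omega) (by omega) hnp), pow_one]

section Binomial

variable {F : Type*} [Field F] {q I J : ℕ} {α : F}

theorem binomial_div_eq_iff {t y : F} (ht : t ≠ 0) (hy : y ≠ 0) :
    ((t * y) ^ q ^ I + α * (t * y) ^ q ^ J) / (t * y) = (y ^ q ^ I + α * y ^ q ^ J) / y ↔
      (t ^ q ^ I - t) * y ^ q ^ I = -α * (t ^ q ^ J - t) * y ^ q ^ J := by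
  rw [div_eq_div_iff (mul_ne_zero ht hy) hy, mul_pow, mul_pow]
  constructor
  · intro h
    refine mul_right_cancel₀ hy ?_
    linear_combination h
  · intro h
    linear_combination y * h

theorem not_isScattered_of_norm_eq [Fintype F] {n : ℕ} (hq : 2 ≤ q) (hnp : n.Prime)
    (hcard : Fintype.card F = q ^ n) (hIJ : I < J) (hJ : J < n) (hα : α ≠ 0) {t : F}
    (ht : t ^ q ≠ t) (hI0 : t ^ q ^ I - t ≠ 0) (hJ0 : t ^ q ^ J - t ≠ 0)
    (h : (t ^ q ^ I - t) ^ ((q ^ n - 1) / (q - 1)) =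
      (-α * (t ^ q ^ J - t)) ^ ((q ^ n - 1) / (q - 1))) :
    ¬ IsScattered q (fun x : F => x ^ q ^ I + α * x ^ q ^ J) := by
  intro hs
  have hd0 : -α * (t ^ q ^ J - t) ≠ 0 := mul_ne_zero (neg_ne_zero.2 hα) hJ0
  have ht0 : t ≠ 0 := by
    rintro rfl
    exact ht (zero_pow (by omega))
  obtain ⟨y, hy0, hy⟩ := exists_pow_eq_of_pow_eq_one (m := q ^ J - q ^ I) (d := q - 1)
    (by rw [hcard, gcd_pow_sub_one_pow_sub_pow hq hnp hIJ hJ]) (by omega)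
    (div_ne_zero hI0 hd0) (by rw [hcard, div_pow, h, div_self (pow_ne_zero _ hd0)])
  have h1 := hs (t * y) y (mul_ne_zero ht0 hy0) hy0 ((binomial_div_eq_iff ht0 hy0).2 (by
    have h2 : y ^ q ^ J = y ^ q ^ I * y ^ (q ^ J - q ^ I) := by
      rw [← pow_add, Nat.add_sub_cancel' (Nat.pow_le_pow_right (by omega) hIJ.le)]
    rw [h2, hy, mul_left_comm, mul_div_cancel₀ _ hd0, mul_comm]))
  rw [mul_div_cancel_right₀ t hy0] at h1
  exact ht h1

theorem norm_eq_of_binomial_div_eq [Fintype F] {n : ℕ} (hq : 2 ≤ q) (hn : n ≠ 0)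
    (hcard : Fintype.card F = q ^ n) {t y : F} (hy : y ≠ 0)
    (h : (t ^ q ^ I - t) * y ^ q ^ I = -α * (t ^ q ^ J - t) * y ^ q ^ J) :
    (t ^ q ^ I - t) ^ ((q ^ n - 1) / (q - 1)) =
      (-α * (t ^ q ^ J - t)) ^ ((q ^ n - 1) / (q - 1)) := by
  have h1 := congrArg (· ^ ((q ^ n - 1) / (q - 1))) h
  simp only [mul_pow _ (y ^ _)] at h1
  rw [pow_pow_norm_eq hq hn hcard, pow_pow_norm_eq hq hn hcard] at h1
  exact mul_right_cancel₀ (pow_ne_zero _ hy) h1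

end Binomial

end

/-- Let `n ≥ 5` be a prime and `q` a prime power with `q ≥ 2 ^ ((13/3) * n + 4)`. Then for all
`1 ≤ I < J ≤ n - 1` and all nonzero `α ∈ F_{q^n}`, the binomial `x ^ q ^ I + α * x ^ q ^ J` is
scattered over `F_{q^n}` iff `I + J = n` and `N_{q^n/q}(α) ≠ 1`, i.e. the only scattered
binomials over `F_{q^n}` are of Lunardon–Polverino type. -/
theorem stmt_1 (p e : ℕ) (hp : p.Prime) (he : 0 < e) (q : ℕ) (hq : q = p ^ e)
    (n : ℕ) (hn : 5 ≤ n) (hnprime : n.Prime)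
    (hqbig : (2 : ℝ) ^ ((13 / 3 : ℝ) * (n : ℝ) + 4) ≤ (q : ℝ))
    (F : Type*) [Field F] [Fintype F] (hcard : Fintype.card F = q ^ n) :
    ∀ I J : ℕ, 1 ≤ I → I < J → J ≤ n - 1 → ∀ α : F, α ≠ 0 →
      (IsScattered q (fun x : F => x ^ q ^ I + α * x ^ q ^ J) ↔
        I + J = n ∧ α ^ ((q ^ n - 1) / (q - 1)) ≠ 1) := by
  subst hq
  have : Fact p.Prime := ⟨hp⟩
  have : CharP F p := charP_of_card_eq_prime_pow (f := e * n) (by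
    rw [← Nat.card_eq_fintype_card] at *; rw [hcard, pow_mul])
  have hbig := eight_mul_pow_nine_le_of_two_rpow_le hn hqbig
  have hq2 : 2 ≤ p ^ e := by
    have := Nat.pow_le_pow_left hn 9
    omega
  have hodd : Odd n := hnprime.odd_of_ne_two (by omega)
  intro I J hI hIJ hJ α hα
  have hJn : J < n := by omega
  set M := ((p ^ e) ^ n - 1) / (p ^ e - 1) with hM
  have hfixed : (α ^ M) ^ p ^ e = α ^ M := pow_norm_pow_eq hq2 (by omega) hcard α
  have hcomp : I + J = n → ∀ t : F, (t ^ (p ^ e) ^ J - t) ^ M = -(t ^ (p ^ e) ^ I - t) ^ M :=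
    fun h t => norm_pow_sub_complement hq2 hodd hcard (by rw [h, Nat.mod_self]) t
  have hnorm : ∀ t : F, (-α * (t ^ (p ^ e) ^ J - t)) ^ M = -α ^ M * (t ^ (p ^ e) ^ J - t) ^ M := by
    intro t
    rw [mul_pow, neg_pow_norm hq2 hodd]
  have hno : ∀ t : F, t ^ p ^ e ≠ t →
      (t ^ (p ^ e) ^ I - t) ^ M = -α ^ M * (t ^ (p ^ e) ^ J - t) ^ M →
      ¬ IsScattered (p ^ e) (fun x : F => x ^ (p ^ e) ^ I + α * x ^ (p ^ e) ^ J) :=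
    fun t ht h => not_isScattered_of_norm_eq hq2 hnprime hcard hIJ hJn hα ht
      (sub_ne_zero_of_pow_ne hnprime hcard hI (hIJ.trans hJn) ht)
      (sub_ne_zero_of_pow_ne hnprime hcard (hI.trans hIJ.le) hJn ht) (h.trans (hnorm t).symm)
  constructor
  · intro hs
    have hsum : I + J = n := by
      by_contra hsum
      obtain ⟨t, ht, h⟩ := exists_norm_pow_sub_eq_of_add_ne hnprime hcard hn hbig hI hIJ hJn hsum
        (c := -α ^ M) (by simpa [hfixed] using neg_pow_pow_char (p := p) (e := e) (α ^ M) 1)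
        (neg_ne_zero.2 (pow_ne_zero _ hα))
      exact hno t ht h hs
    refine ⟨hsum, fun h1 => ?_⟩
    obtain ⟨t, ht⟩ := exists_pow_ne_self hq2 (by omega) hcard
    refine hno t ht ?_ hs
    rw [h1, hcomp hsum, neg_mul_neg, one_mul]
  · rintro ⟨hsum, h1⟩ x y hx hy hxy
    by_contra ht
    have hx' : x = x / y * y := (div_mul_cancel₀ x hy).symm
    generalize hxt : x / y = t at ht hx'
    have ht0 : t ≠ 0 := hxt ▸ div_ne_zero hx hy
    subst hx'
    have h2 := norm_eq_of_binomial_div_eq hq2 (by omega) hcard hy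
      ((binomial_div_eq_iff ht0 hy).1 hxy)
    rw [hnorm, hcomp hsum, neg_mul_neg] at h2
    exact h1 (mul_right_cancel₀ (pow_ne_zero _
      (sub_ne_zero_of_pow_ne hnprime hcard hI (hIJ.trans hJn) ht)) (by rw [one_mul]; exact h2.symm))
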